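/- arXiv:0912.2444 — 3 statements merged into one kernel-verified Lean document; each statement's English description precedes it below -/
import Mathlib

section
/- Fix a real constant c > 0. For each N let G(N, ⌊cN⌋) be the Erdős–Rényi directed multigraph on [N] with ⌊cN⌋ edges, and let I_N denote the maximum cardinality of an independent set of G(N, ⌊cN⌋). Then there exists a constant H(c) ∈ [0,1] such that I_N / N converges to H(c) with high probability as N → ∞. -/
open Filter
open scoped Classical

/-- Probability of an event `p` when an edge list of `M` directed edges on vertex set
`Fin N` is drawn uniformly at random (i.e. the `M` edges are i.i.d. uniform ordered pairs). -/
noncomputable def probER (N M : ℕ) (p : (Fin M → Fin N × Fin N) → Prop) : ℝ :=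
  (((Finset.univ : Finset (Fin M → Fin N × Fin N)).filter p).card : ℝ) /
    (Fintype.card (Fin M → Fin N × Fin N) : ℝ)

/-- `S` is an independent set for the edge list `E`: no edge has both endpoints in `S`. -/
def IsIndepSet {N M : ℕ} (E : Fin M → Fin N × Fin N) (S : Finset (Fin N)) : Prop :=
  ∀ m : Fin M, ¬((E m).1 ∈ S ∧ (E m).2 ∈ S)

/-- The maximum cardinality of an independent set of the edge list `E`. -/
noncomputable def maxIndepER {N M : ℕ} (E : Fin M → Fin N × Fin N) : ℕ :=
  Finset.sup ((Finset.univ : Finset (Finset (Fin N))).filter (IsIndepSet E)) Finset.card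

open scoped BigOperators

/-- The average of `F` over all lists of length `M` with entries in the finite type `X`. -/
noncomputable def listAvg {X : Type*} [Fintype X] : ℕ → (List X → ℝ) → ℝ
  | 0, F => F []
  | M + 1, F => 𝔼 e : X, listAvg M (fun l => F (e :: l))

section pullbackList

variable {X Y : Type*}

/-- The entries of `l` in the range of `ι`, pulled back along `ι`. -/
noncomputable def pullbackList (ι : Y → X) (l : List X) : List Y :=
  l.filterMap (Function.partialInv ι)

lemma mem_pullbackList {ι : Y → X} (hι : Function.Injective ι) {l : List X} {y : Y} :
    y ∈ pullbackList ι l ↔ ι y ∈ l := by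
  simp only [pullbackList, List.mem_filterMap]
  constructor
  · rintro ⟨x, hx, h⟩
    rwa [(hι.isPartialInv y x).1 h]
  · exact fun h => ⟨_, h, hι.isPartialInv.eq y⟩

lemma length_pullbackList_le (ι : Y → X) (l : List X) :
    (pullbackList ι l).length ≤ l.length :=
  List.length_filterMap_le _ _

lemma pullbackList_cons (ι : Y → X) (x : X) (l : List X) :
    pullbackList ι (x :: l) =
      (Function.partialInv ι x).elim (pullbackList ι l) (· :: pullbackList ι l) := by
  unfold pullbackList
  cases h : Function.partialInv ι x <;> simp [h]

end pullbackList

section listAvg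

variable {X Y : Type*} [Fintype X] [Fintype Y]

lemma listAvg_succ (M : ℕ) (F : List X → ℝ) :
    listAvg (M + 1) F = 𝔼 e : X, listAvg M (fun l => F (e :: l)) := rfl

lemma listAvg_mono_length {M : ℕ} {F G : List X → ℝ}
    (h : ∀ l : List X, l.length = M → F l ≤ G l) : listAvg M F ≤ listAvg M G := by
  induction M generalizing F G with
  | zero => exact h [] rfl
  | succ M ih =>
    exact Finset.expect_le_expect fun e _ => ih fun l hl => h (e :: l) (by simp [hl])

lemma listAvg_mono {M : ℕ} {F G : List X → ℝ} (h : ∀ l, F l ≤ G l) :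
    listAvg M F ≤ listAvg M G :=
  listAvg_mono_length fun l _ => h l

lemma listAvg_add (M : ℕ) (F G : List X → ℝ) :
    listAvg M (fun l => F l + G l) = listAvg M F + listAvg M G := by
  induction M generalizing F G with
  | zero => rfl
  | succ M ih => simp only [listAvg_succ, ih, Finset.expect_add_distrib]

lemma listAvg_mul_left (M : ℕ) (a : ℝ) (F : List X → ℝ) :
    listAvg M (fun l => a * F l) = a * listAvg M F := by
  induction M generalizing F with
  | zero => rfl
  | succ M ih => simp only [listAvg_succ, ih, Finset.mul_expect]

lemma listAvg_const [Nonempty X] (M : ℕ) (a : ℝ) : listAvg M (fun _ : List X => a) = a := by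
  induction M with
  | zero => rfl
  | succ M ih => simp only [listAvg_succ, ih, Fintype.expect_const]

lemma listAvg_sum {ι : Type*} (s : Finset ι) (M : ℕ) (F : ι → List X → ℝ) :
    listAvg M (fun l => ∑ i ∈ s, F i l) = ∑ i ∈ s, listAvg M (F i) := by
  induction M generalizing F with
  | zero => rfl
  | succ M ih => simp only [listAvg_succ, ih, Finset.expect_sum_comm]

lemma listAvg_expect {ι : Type*} (s : Finset ι) (M : ℕ) (F : ι → List X → ℝ) :
    listAvg M (fun l => 𝔼 i ∈ s, F i l) = 𝔼 i ∈ s, listAvg M (F i) := by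
  induction M generalizing F with
  | zero => rfl
  | succ M ih =>
    simp only [listAvg_succ, ih]
    exact Finset.expect_comm _ _ _

/-- Averaging over lists of length `M` is averaging over functions from `Fin M`. -/
lemma listAvg_eq_sum_div (M : ℕ) (F : List X → ℝ) :
    listAvg M F = (∑ E : Fin M → X, F (List.ofFn E)) / Fintype.card (Fin M → X) := by
  induction M generalizing F with
  | zero => simp [listAvg]
  | succ M ih =>
    simp only [listAvg_succ, ih, Fintype.expect_eq_sum_div_card]
    rw [← (Fin.consEquiv fun _ : Fin (M + 1) => X).sum_comp, Fintype.sum_prod_type,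
      ← Finset.sum_div, div_div]
    congr 1
    · simp [Fin.consEquiv, List.ofFn_succ]
    · simp [pow_succ]

/-- The bounded-difference variance estimate. -/
lemma listAvg_sq_sub_le [Nonempty X] (M : ℕ) (F : List X → ℝ)
    (hF : ∀ l₁ e l₂, F (l₁ ++ e :: l₂) ≤ F (l₁ ++ l₂) ∧ F (l₁ ++ l₂) - 1 ≤ F (l₁ ++ e :: l₂)) :
    listAvg M (fun l => (F l - listAvg M F) ^ 2) ≤ M := by
  induction M generalizing F with
  | zero => simp [listAvg]
  | succ M ih =>
    set m : X → ℝ := fun e => listAvg M (fun l => F (e :: l)) with hm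
    have hmle : ∀ e, m e ≤ listAvg M F := fun e => listAvg_mono fun l => (hF [] e l).1
    have hmge : ∀ e, listAvg M F - 1 ≤ m e := fun e => by
      have : listAvg M (fun l => F l + (-1)) ≤ m e :=
        listAvg_mono fun l => by simpa [sub_eq_add_neg] using (hF [] e l).2
      rw [listAvg_add, listAvg_const] at this
      linarith
    have hμ : listAvg (M + 1) F = 𝔼 e, m e := rfl
    have hμle : 𝔼 e, m e ≤ listAvg M F := by
      have := Finset.expect_le_expect (s := Finset.univ) fun e _ => hmle e
      rwa [Fintype.expect_const] at this
    have hμge : listAvg M F - 1 ≤ 𝔼 e, m e := by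
      have := Finset.expect_le_expect (s := Finset.univ) fun e _ => hmge e
      rwa [Fintype.expect_const] at this
    rw [listAvg_succ, hμ]
    calc 𝔼 e : X, listAvg M (fun l => (F (e :: l) - 𝔼 e, m e) ^ 2)
        ≤ 𝔼 _e : X, ((M : ℝ) + 1) := by
          refine Finset.expect_le_expect fun e _ => ?_
          set μ := 𝔼 e, m e
          have hvar := ih (fun l => F (e :: l)) fun l₁ e' l₂ => by
            simpa using hF (e :: l₁) e' l₂
          have hexp : listAvg M (fun l => (F (e :: l) - μ) ^ 2)
              = listAvg M (fun l => (F (e :: l) - m e) ^ 2) + (m e - μ) ^ 2 := by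
            have : ∀ l, (F (e :: l) - μ) ^ 2 = (F (e :: l) - m e) ^ 2
                + (2 * (m e - μ) * F (e :: l) + ((m e - μ) ^ 2 - 2 * (m e - μ) * m e)) :=
              fun l => by ring
            simp only [this]
            rw [listAvg_add, listAvg_add, listAvg_mul_left, listAvg_const]
            ring
          rw [hexp]
          have : (m e - μ) ^ 2 ≤ 1 := by
            have := hmle e
            have := hmge e
            rw [sq_le_one_iff_abs_le_one, abs_le]
            constructor <;> linarith
          exact add_le_add hvar this
      _ = ((M + 1 : ℕ) : ℝ) := by rw [Fintype.expect_const]; push_cast; rfl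

lemma expect_partialInv [Nonempty X] [Nonempty Y] {ι : Y → X} (hι : Function.Injective ι)
    (h : Option Y → ℝ) :
    𝔼 x, h (Function.partialInv ι x)
      = (Fintype.card Y / Fintype.card X : ℝ) * (𝔼 y, h (some y))
        + (1 - Fintype.card Y / Fintype.card X : ℝ) * h none := by
  have hX : (Fintype.card X : ℝ) ≠ 0 := by exact_mod_cast Fintype.card_ne_zero
  have hY : (Fintype.card Y : ℝ) ≠ 0 := by exact_mod_cast Fintype.card_ne_zero
  have hinv := hι.isPartialInv
  have key : ∑ y, (h (some y) - h none) = ∑ x, (h (Function.partialInv ι x) - h none) := by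
    refine Finset.sum_of_injOn ι hι.injOn (fun _ _ => by simp) (fun x _ hx => ?_)
      fun y _ => by rw [hinv.eq]
    cases hx' : Function.partialInv ι x with
    | none => simp
    | some y => exact absurd ⟨y, by simp, (hinv y x).1 hx'⟩ hx
  simp only [Finset.sum_sub_distrib, Finset.sum_const, Finset.card_univ, nsmul_eq_mul] at key
  simp only [Fintype.expect_eq_sum_div_card]
  field_simp
  linarith

/-- Conditionally on its length, the pullback of a uniform list is a uniform list. -/
lemma listAvg_pullbackList [Nonempty X] [Nonempty Y] {ι : Y → X} (hι : Function.Injective ι)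
    (M : ℕ) (F : List Y → ℝ) :
    listAvg M (fun l => F (pullbackList ι l))
      = listAvg M (fun l => listAvg (pullbackList ι l).length F) := by
  induction M generalizing F with
  | zero => simp [listAvg, pullbackList]
  | succ M ih =>
    simp only [listAvg_succ, pullbackList_cons]
    rw [expect_partialInv hι
        (fun o => listAvg M fun l => F (o.elim (pullbackList ι l) (· :: pullbackList ι l))),
      expect_partialInv hι (fun o => listAvg M fun l =>
        listAvg (o.elim (pullbackList ι l) (· :: pullbackList ι l)).length F)]
    simp only [Option.elim, List.length_cons, listAvg_succ, ih, Fintype.expect_const]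
    congr 2
    rw [listAvg_expect]
    exact Finset.expect_congr rfl fun y _ => ih fun l => F (y :: l)

lemma listAvg_sq_length_pullbackList [Nonempty X] [Nonempty Y] {ι : Y → X}
    (hι : Function.Injective ι) (M : ℕ) (t : ℝ) :
    listAvg M (fun l => ((pullbackList ι l).length
        - M * (Fintype.card Y / Fintype.card X : ℝ) + t) ^ 2)
      = t ^ 2 + M * ((Fintype.card Y / Fintype.card X : ℝ)
          * (1 - Fintype.card Y / Fintype.card X : ℝ)) := by
  set p : ℝ := Fintype.card Y / Fintype.card X with hp
  induction M generalizing t with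
  | zero => simp [listAvg, pullbackList]
  | succ M ih =>
    simp only [listAvg_succ, pullbackList_cons]
    rw [expect_partialInv hι (fun o => listAvg M fun l =>
      (((o.elim (pullbackList ι l) (· :: pullbackList ι l)).length : ℝ)
        - (M + 1 : ℕ) * p + t) ^ 2)]
    have h1 := ih (t + 1 - p)
    have h2 := ih (t - p)
    simp only [Option.elim, List.length_cons, Fintype.expect_const, ← hp]
    have e1 : ∀ l : List X, (((pullbackList ι l).length + 1 : ℕ) - (M + 1 : ℕ) * p + t : ℝ)
        = (pullbackList ι l).length - M * p + (t + 1 - p) := fun l => by push_cast; ring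
    have e2 : ∀ l : List X, ((pullbackList ι l).length - (M + 1 : ℕ) * p + t : ℝ)
        = (pullbackList ι l).length - M * p + (t - p) := fun l => by push_cast; ring
    simp only [e1, e2, h1, h2]
    push_cast
    ring

end listAvg

section indepNum

variable {V W : Type*} [Fintype V] [Fintype W]

/-- `S` contains both endpoints of no edge of the list `l`. -/
def IsIndepFor {V : Type*} (l : List (V × V)) (S : Finset V) : Prop :=
  ∀ e ∈ l, ¬(e.1 ∈ S ∧ e.2 ∈ S)

/-- The independence number of the multigraph on `V` with edge list `l`. -/
noncomputable def indepNum (l : List (V × V)) : ℕ :=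
  ((Finset.univ : Finset (Finset V)).filter (IsIndepFor l)).sup Finset.card

lemma IsIndepFor.card_le {l : List (V × V)} {S : Finset V} (h : IsIndepFor l S) :
    S.card ≤ indepNum l :=
  Finset.le_sup (f := Finset.card) (by simpa using h)

lemma exists_isIndepFor_card_eq (l : List (V × V)) :
    ∃ S, IsIndepFor l S ∧ S.card = indepNum l := by
  obtain ⟨S, hS, h⟩ := Finset.exists_mem_eq_sup
    ((Finset.univ : Finset (Finset V)).filter (IsIndepFor l)) ⟨∅, by simp [IsIndepFor]⟩ Finset.card
  exact ⟨S, by simpa using hS, h.symm⟩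

lemma indepNum_le_card (l : List (V × V)) : indepNum l ≤ Fintype.card V :=
  Finset.sup_le fun S _ => S.card_le_univ

lemma indepNum_antitone {l l' : List (V × V)} (h : l ⊆ l') : indepNum l' ≤ indepNum l := by
  obtain ⟨S, hS, hc⟩ := exists_isIndepFor_card_eq l'
  exact hc ▸ IsIndepFor.card_le fun e he => hS e (h he)

lemma indepNum_perm {l l' : List (V × V)} (h : l.Perm l') : indepNum l = indepNum l' :=
  le_antisymm (indepNum_antitone h.symm.subset) (indepNum_antitone h.subset)

/-- The vertices belonging to every maximum independent set. -/
def indepCore (l : List (V × V)) : Set V :=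
  {v | ∀ S, IsIndepFor l S → S.card = indepNum l → v ∈ S}

lemma indepNum_le_indepNum_cons_add_one (e : V × V) (l : List (V × V)) :
    indepNum l ≤ indepNum (e :: l) + 1 := by
  obtain ⟨S, hS, hc⟩ := exists_isIndepFor_card_eq l
  have : IsIndepFor (e :: l) (S.erase e.1) := by
    intro e' he' h
    rcases List.mem_cons.1 he' with rfl | he'
    · simp at h
    · exact hS e' he' ⟨Finset.mem_of_mem_erase h.1, Finset.mem_of_mem_erase h.2⟩
  have := this.card_le
  have := S.pred_card_le_card_erase (a := e.1)
  omega

lemma indepNum_cons (e : V × V) (l : List (V × V)) :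
    (indepNum (e :: l) : ℝ)
      = indepNum l - (indepCore l).indicator 1 e.1 * (indepCore l).indicator 1 e.2 := by
  have hle : indepNum (e :: l) ≤ indepNum l := indepNum_antitone (List.subset_cons_self e l)
  by_cases h : e.1 ∈ indepCore l ∧ e.2 ∈ indepCore l
  · rw [Set.indicator_of_mem h.1, Set.indicator_of_mem h.2]
    have hlt : indepNum (e :: l) < indepNum l := by
      refine lt_of_le_of_ne hle fun heq => ?_
      obtain ⟨S, hS, hc⟩ := exists_isIndepFor_card_eq (e :: l)
      have hS' : IsIndepFor l S := fun e' he' => hS e' (List.mem_cons_of_mem _ he')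
      exact hS e List.mem_cons_self ⟨h.1 S hS' (hc.trans heq), h.2 S hS' (hc.trans heq)⟩
    have : indepNum l = indepNum (e :: l) + 1 :=
      le_antisymm (indepNum_le_indepNum_cons_add_one e l) hlt
    rw [this]
    simp
  · have : ∃ S, IsIndepFor l S ∧ S.card = indepNum l ∧ ¬(e.1 ∈ S ∧ e.2 ∈ S) := by
      by_contra! hcon
      exact h ⟨fun S hS hc => (hcon S hS hc).1, fun S hS hc => (hcon S hS hc).2⟩
    obtain ⟨S, hS, hc, hn⟩ := this
    have hS' : IsIndepFor (e :: l) S := by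
      intro e' he'
      rcases List.mem_cons.1 he' with rfl | he'
      · exact hn
      · exact hS e' he'
    have := hS'.card_le
    have h0 : (indepCore l).indicator (1 : V → ℝ) e.1 * (indepCore l).indicator 1 e.2 = 0 := by
      by_contra hne
      exact h ⟨Set.mem_of_indicator_ne_zero (left_ne_zero_of_mul hne),
        Set.mem_of_indicator_ne_zero (right_ne_zero_of_mul hne)⟩
    rw [h0, sub_zero]
    exact_mod_cast le_antisymm hle (hc ▸ this)

lemma indepNum_bounded_difference (l₁ : List (V × V)) (e : V × V) (l₂ : List (V × V)) :
    (indepNum (l₁ ++ e :: l₂) : ℝ) ≤ indepNum (l₁ ++ l₂) ∧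
      (indepNum (l₁ ++ l₂) : ℝ) - 1 ≤ indepNum (l₁ ++ e :: l₂) := by
  rw [indepNum_perm (List.perm_middle : (l₁ ++ e :: l₂).Perm (e :: (l₁ ++ l₂)))]
  have h1 := indepNum_antitone (List.subset_cons_self e (l₁ ++ l₂))
  have h2 := indepNum_le_indepNum_cons_add_one e (l₁ ++ l₂)
  exact ⟨by exact_mod_cast h1, by rw [sub_le_iff_le_add]; exact_mod_cast h2⟩

/-- A vertex embedding bounds the independence number by that of the pulled back edges. -/
lemma indepNum_pullbackList_le {ι : W → V} (hι : Function.Injective ι) (l : List (V × V)) :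
    indepNum (pullbackList (Prod.map ι ι) l) ≤ indepNum l := by
  obtain ⟨S, hS, hc⟩ := exists_isIndepFor_card_eq (pullbackList (Prod.map ι ι) l)
  have : IsIndepFor l (S.map ⟨ι, hι⟩) := by
    rintro ⟨u, v⟩ he ⟨hu, hv⟩
    obtain ⟨a, ha, rfl⟩ := Finset.mem_map.1 hu
    obtain ⟨b, hb, rfl⟩ := Finset.mem_map.1 hv
    exact hS (a, b) ((mem_pullbackList (hι.prodMap hι)).2 he) ⟨ha, hb⟩
  have := this.card_le
  rwa [Finset.card_map, hc] at this

/-- The edge of the block graph on `J × W` given by a block and an edge on `W`. -/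
def blockEdge {J W : Type*} (b : J × W × W) : (J × W) × (J × W) :=
  ((b.1, b.2.1), (b.1, b.2.2))

lemma sum_indepNum_le_indepNum_map_blockEdge {J : Type*} [Fintype J] (l : List (J × W × W)) :
    ∑ j, indepNum (pullbackList (Prod.mk j) l) ≤ indepNum (l.map blockEdge) := by
  choose S hS hc using fun j : J => exists_isIndepFor_card_eq (pullbackList (Prod.mk j) l)
  have : IsIndepFor (l.map blockEdge) (Finset.univ.filter fun x : J × W => x.2 ∈ S x.1) := by
    intro e he
    obtain ⟨⟨j, u, v⟩, hb, rfl⟩ := List.mem_map.1 he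
    have := hS j (u, v) ((mem_pullbackList (Prod.mk_right_injective j)).2 hb)
    simpa [blockEdge] using this
  refine le_trans (le_of_eq ?_) this.card_le
  rw [Finset.card_filter, Fintype.sum_prod_type]
  refine Finset.sum_congr rfl fun j _ => ?_
  rw [← hc]
  simp

/-- One step of the interpolation: a random edge inside a random block decreases the
independence number at least as much, on average, as a random edge of the whole graph. -/
lemma expect_indepNum_blockEdge_le {J : Type*} [Fintype J] [Nonempty J] [Nonempty W]
    (l : List ((J × W) × (J × W))) :
    𝔼 b : J × W × W, (indepNum (blockEdge b :: l) : ℝ)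
      ≤ 𝔼 e : (J × W) × (J × W), (indepNum (e :: l) : ℝ) := by
  simp only [indepNum_cons, Finset.expect_sub_distrib, Fintype.expect_const]
  refine sub_le_sub_left ?_ _
  set x : J × W → ℝ := (indepCore l).indicator 1
  set c : J → ℝ := fun j => ∑ w, x (j, w)
  have hJ : (0 : ℝ) < Fintype.card J := by exact_mod_cast Fintype.card_pos
  have hW : (0 : ℝ) < Fintype.card W := by exact_mod_cast Fintype.card_pos
  have h1 : ∑ e : (J × W) × (J × W), x e.1 * x e.2 = (∑ j, c j) ^ 2 := by
    rw [Fintype.sum_prod_type, ← Finset.sum_mul_sum, ← sq, Fintype.sum_prod_type]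
  have h2 : ∑ b : J × W × W, x (blockEdge b).1 * x (blockEdge b).2 = ∑ j, c j ^ 2 := by
    rw [Fintype.sum_prod_type]
    refine Finset.sum_congr rfl fun j _ => ?_
    rw [Fintype.sum_prod_type, sq, Finset.sum_mul_sum]
    rfl
  have hcs : (∑ j, c j) ^ 2 ≤ Fintype.card J * ∑ j, c j ^ 2 := sq_sum_le_card_mul_sum_sq
  rw [Fintype.expect_eq_sum_div_card, Fintype.expect_eq_sum_div_card, h1, h2]
  simp only [Fintype.card_prod, Nat.cast_mul]
  rw [div_le_div_iff₀ (by positivity) (by positivity)]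
  calc (∑ j, c j) ^ 2 * (Fintype.card J * (Fintype.card W * Fintype.card W) : ℝ)
      ≤ (Fintype.card J * ∑ j, c j ^ 2)
        * (Fintype.card J * (Fintype.card W * Fintype.card W) : ℝ) := by gcongr
    _ = _ := by ring

lemma listAvg_indepNum_blockEdge_append_le {J : Type*} [Fintype J] [Nonempty J] [Nonempty W]
    (M : ℕ) (l₀ : List ((J × W) × (J × W))) :
    listAvg M (fun l : List (J × W × W) => (indepNum (l.map blockEdge ++ l₀) : ℝ))
      ≤ listAvg M (fun l => (indepNum (l ++ l₀) : ℝ)) := by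
  induction M generalizing l₀ with
  | zero => exact le_rfl
  | succ M ih =>
    calc listAvg (M + 1) (fun l : List (J × W × W) => (indepNum (l.map blockEdge ++ l₀) : ℝ))
        = listAvg M (fun l : List (J × W × W) =>
            𝔼 b : J × W × W, (indepNum (blockEdge b :: (l.map blockEdge ++ l₀)) : ℝ)) := by
          rw [listAvg_expect]
          rfl
      _ ≤ listAvg M (fun l : List (J × W × W) =>
            𝔼 e : (J × W) × (J × W), (indepNum (e :: (l.map blockEdge ++ l₀)) : ℝ)) :=
          listAvg_mono fun l => expect_indepNum_blockEdge_le _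
      _ = 𝔼 e : (J × W) × (J × W), listAvg M (fun l : List (J × W × W) =>
            (indepNum (l.map blockEdge ++ e :: l₀) : ℝ)) := by
          rw [listAvg_expect]
          simp only [indepNum_perm List.perm_middle]
      _ ≤ 𝔼 e : (J × W) × (J × W), listAvg M (fun l => (indepNum (l ++ e :: l₀) : ℝ)) :=
          Finset.expect_le_expect fun e _ => ih (e :: l₀)
      _ = listAvg (M + 1) (fun l => (indepNum (l ++ l₀) : ℝ)) := by
          simp only [indepNum_perm List.perm_middle]
          rfl

variable (V W) in
/-- The expected independence number of a uniform multigraph on `V` with `M` edges. -/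
noncomputable def meanIndepNum (M : ℕ) : ℝ :=
  listAvg M (fun l : List (V × V) => (indepNum l : ℝ))

lemma meanIndepNum_nonneg [Nonempty V] (M : ℕ) : 0 ≤ meanIndepNum V M := by
  have : listAvg M (fun _ : List (V × V) => (0 : ℝ)) ≤ meanIndepNum V M :=
    listAvg_mono fun l => by positivity
  rwa [listAvg_const] at this

lemma meanIndepNum_le_card [Nonempty V] (M : ℕ) : meanIndepNum V M ≤ Fintype.card V := by
  have : meanIndepNum V M ≤ listAvg M (fun _ : List (V × V) => (Fintype.card V : ℝ)) :=
    listAvg_mono fun l => by exact_mod_cast indepNum_le_card l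
  rwa [listAvg_const] at this

lemma meanIndepNum_succ_le [Nonempty V] (M : ℕ) : meanIndepNum V (M + 1) ≤ meanIndepNum V M := by
  have := Finset.expect_le_expect (s := (Finset.univ : Finset (V × V)))
    (f := fun e => listAvg M fun l => (indepNum (e :: l) : ℝ)) (g := fun _ => meanIndepNum V M)
    fun e _ => listAvg_mono fun l => (indepNum_bounded_difference [] e l).1
  rwa [Fintype.expect_const] at this

lemma meanIndepNum_sub_one_le [Nonempty V] (M : ℕ) :
    meanIndepNum V M - 1 ≤ meanIndepNum V (M + 1) := by
  have := Finset.expect_le_expect (s := (Finset.univ : Finset (V × V)))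
    (f := fun _ => listAvg M fun l : List (V × V) => (indepNum l : ℝ) + (-1))
    (g := fun e => listAvg M fun l => (indepNum (e :: l) : ℝ))
    fun e _ => listAvg_mono fun l => (indepNum_bounded_difference [] e l).2
  rwa [Fintype.expect_const, listAvg_add, listAvg_const] at this

lemma meanIndepNum_antitone [Nonempty V] : Antitone (meanIndepNum V) :=
  antitone_nat_of_succ_le meanIndepNum_succ_le

lemma meanIndepNum_sub_abs_le [Nonempty V] (m m₀ : ℕ) :
    meanIndepNum V m₀ - |(m : ℝ) - m₀| ≤ meanIndepNum V m := by
  rcases le_total m m₀ with h | h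
  · have := meanIndepNum_antitone (V := V) h
    have := abs_nonneg ((m : ℝ) - m₀)
    linarith
  · obtain ⟨d, rfl⟩ := Nat.exists_eq_add_of_le h
    have : meanIndepNum V m₀ - d ≤ meanIndepNum V (m₀ + d) := by
      clear h
      induction d with
      | zero => simp
      | succ d ih =>
        have := meanIndepNum_sub_one_le (V := V) (m₀ + d)
        rw [← add_assoc]
        push_cast
        linarith
    simpa using this

lemma meanIndepNum_le_of_injective [Nonempty V] [Nonempty W] {ι : W → V}
    (hι : Function.Injective ι) (M : ℕ) : meanIndepNum W M ≤ meanIndepNum V M := by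
  have h1 : listAvg M (fun l : List (V × V) =>
      (indepNum (pullbackList (Prod.map ι ι) l) : ℝ)) ≤ meanIndepNum V M :=
    listAvg_mono fun l => by exact_mod_cast indepNum_pullbackList_le hι l
  rw [listAvg_pullbackList (hι.prodMap hι) M fun l => (indepNum l : ℝ)] at h1
  refine le_trans ?_ h1
  have h2 : listAvg M (fun _ : List (V × V) => meanIndepNum W M) ≤ listAvg M
      (fun l => meanIndepNum W (pullbackList (Prod.map ι ι) l).length) :=
    listAvg_mono_length fun l hl =>
      meanIndepNum_antitone (hl ▸ length_pullbackList_le (Prod.map ι ι) l)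
  rwa [listAvg_const] at h2

/-- Near-superadditivity of the mean independence number over `J` equal blocks. -/
lemma card_mul_meanIndepNum_sub_le {J : Type*} [Fintype J] [Nonempty J] [Nonempty W]
    (M m₀ : ℕ) {s : ℝ} (hs : 0 < s) :
    Fintype.card J * (meanIndepNum W m₀
        - (((M : ℝ) / Fintype.card J - m₀) ^ 2 + M / Fintype.card J) / (2 * s) - s / 2)
      ≤ meanIndepNum (J × W) M := by
  have hJ : (0 : ℝ) < Fintype.card J := by exact_mod_cast Fintype.card_pos
  have hW : (0 : ℝ) < Fintype.card W := by exact_mod_cast Fintype.card_pos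
  have h1 := listAvg_indepNum_blockEdge_append_le (J := J) (W := W) M []
  simp only [List.append_nil] at h1
  refine le_trans ?_ h1
  have h2 : listAvg M (fun l : List (J × W × W) =>
      ∑ j, (indepNum (pullbackList (Prod.mk j) l) : ℝ)) ≤
      listAvg M (fun l : List (J × W × W) => (indepNum (l.map blockEdge) : ℝ)) :=
    listAvg_mono fun l => by exact_mod_cast sum_indepNum_le_indepNum_map_blockEdge l
  refine le_trans ?_ h2
  rw [listAvg_sum, ← nsmul_eq_mul]
  refine Finset.card_nsmul_le_sum Finset.univ _ _ fun j _ => ?_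
  have hinj : Function.Injective (Prod.mk j : W × W → J × W × W) := Prod.mk_right_injective j
  rw [listAvg_pullbackList hinj M fun l => (indepNum l : ℝ)]
  set p : ℝ := Fintype.card (W × W) / Fintype.card (J × W × W) with hp
  have hp' : p = 1 / Fintype.card J := by
    rw [hp]
    simp only [Fintype.card_prod, Nat.cast_mul]
    field_simp
  have hvar := listAvg_sq_length_pullbackList hinj M (M * p - m₀)
  rw [← hp] at hvar
  simp only [sub_add_sub_cancel] at hvar
  have hlow : ∀ l : List (J × W × W),
      (-1 / (2 * s)) * ((pullbackList (Prod.mk j) l).length - (m₀ : ℝ)) ^ 2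
        + (meanIndepNum W m₀ - s / 2) ≤ meanIndepNum W (pullbackList (Prod.mk j) l).length := by
    intro l
    have h := meanIndepNum_sub_abs_le (V := W) (pullbackList (Prod.mk j) l).length m₀
    generalize hx : ((pullbackList (Prod.mk j) l).length : ℝ) - (m₀ : ℝ) = x at h ⊢
    have hx' : |x| ≤ x ^ 2 / (2 * s) + s / 2 := by
      have : x ^ 2 / (2 * s) + s / 2 - |x| = (|x| - s) ^ 2 / (2 * s) := by
        rw [← sq_abs x]
        field_simp
        ring
      have : 0 ≤ (|x| - s) ^ 2 / (2 * s) := by positivity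
      linarith
    have : (-1 / (2 * s)) * x ^ 2 = -(x ^ 2 / (2 * s)) := by ring
    linarith
  refine le_trans ?_ (listAvg_mono hlow)
  rw [listAvg_add, listAvg_mul_left, listAvg_const, hvar]
  have hq : (M : ℝ) * (p * (1 - p)) ≤ M / Fintype.card J := by
    have : (M : ℝ) / Fintype.card J = M * p := by rw [hp']; ring
    rw [this]
    nlinarith [mul_nonneg (Nat.cast_nonneg (α := ℝ) M) (sq_nonneg p)]
  have hMp : (M : ℝ) * p - m₀ = M / Fintype.card J - m₀ := by rw [hp']; ring
  rw [hMp]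
  have hle : (((M : ℝ) / Fintype.card J - m₀) ^ 2 + M * (p * (1 - p))) / (2 * s)
      ≤ (((M : ℝ) / Fintype.card J - m₀) ^ 2 + M / Fintype.card J) / (2 * s) := by gcongr
  have : (-1 / (2 * s)) * (((M : ℝ) / Fintype.card J - m₀) ^ 2 + M * (p * (1 - p)))
      = -((((M : ℝ) / Fintype.card J - m₀) ^ 2 + M * (p * (1 - p))) / (2 * s)) := by ring
  linarith

end indepNum

lemma maxIndepER_eq_indepNum {N M : ℕ} (E : Fin M → Fin N × Fin N) :
    maxIndepER E = indepNum (List.ofFn E) := by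
  have : ∀ S : Finset (Fin N), IsIndepSet E S ↔ IsIndepFor (List.ofFn E) S := fun S => by
    simp [IsIndepSet, IsIndepFor, List.mem_ofFn]
  simp only [maxIndepER, indepNum, this]

/-- The Chebyshev inequality for the maximum independent set. -/
lemma probER_lt_abs_sub_meanIndepNum_le {N : ℕ} (hN : 0 < N) (M : ℕ) {t : ℝ} (ht : 0 < t)
    {p : (Fin M → Fin N × Fin N) → Prop}
    (hp : ∀ E, p E → t ≤ |(maxIndepER E : ℝ) - meanIndepNum (Fin N) M|) :
    probER N M p ≤ M / t ^ 2 := by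
  have : Nonempty (Fin N) := ⟨⟨0, hN⟩⟩
  have hvar := listAvg_sq_sub_le M (fun l : List (Fin N × Fin N) => (indepNum l : ℝ))
    indepNum_bounded_difference
  rw [listAvg_eq_sum_div] at hvar
  simp only [← maxIndepER_eq_indepNum] at hvar
  refine le_trans ?_ (div_le_div_of_nonneg_right hvar (sq_nonneg t))
  rw [div_right_comm, probER]
  refine div_le_div_of_nonneg_right ?_ (Nat.cast_nonneg _)
  rw [le_div_iff₀ (by positivity), ← nsmul_eq_mul]
  refine le_trans (Finset.card_nsmul_le_sum _
    (fun E => ((maxIndepER E : ℝ) - meanIndepNum (Fin N) M) ^ 2) _ fun E hE => ?_)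
    (Finset.sum_le_sum_of_subset_of_nonneg (Finset.filter_subset _ _) fun _ _ _ => sq_nonneg _)
  rw [← sq_abs ((maxIndepER E : ℝ) - _)]
  exact pow_le_pow_left₀ ht.le (hp E (Finset.mem_filter.1 hE).2) 2

/-- Near-monotonicity of the normalized mean independence number. -/
lemma meanIndepNum_div_sub_le {c : ℝ} (hc : 0 < c) {n N : ℕ} (hn : 0 < n) (hN : n ^ 2 ≤ N) :
    meanIndepNum (Fin n) ⌊c * n⌋₊ / n - ((c + 1) ^ 2 + 2 * c + 1) / 2 / √n - 1 / n
      ≤ meanIndepNum (Fin N) ⌊c * N⌋₊ / N := by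
  set k := N / n with hk
  have hnk : n ≤ k := by rw [hk, Nat.le_div_iff_mul_le hn, ← sq]; exact hN
  have hk0 : 0 < k := hn.trans_le hnk
  have hN0 : 0 < N := lt_of_lt_of_le (by positivity) hN
  have : Nonempty (Fin n) := ⟨⟨0, hn⟩⟩
  have : Nonempty (Fin k) := ⟨⟨0, hk0⟩⟩
  have : Nonempty (Fin N) := ⟨⟨0, hN0⟩⟩
  have hkn : k * n ≤ N := Nat.div_mul_le_self N n
  have hNk : N < (k + 1) * n := by
    rw [← Nat.div_lt_iff_lt_mul hn]
    exact Nat.lt_succ_self _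
  have hinj : Function.Injective (fun x : Fin k × Fin n => Fin.castLE hkn (finProdFinEquiv x)) :=
    (Fin.castLE_injective hkn).comp finProdFinEquiv.injective
  have hnR : (1 : ℝ) ≤ n := by exact_mod_cast hn
  have hkR : (0 : ℝ) < k := by exact_mod_cast hk0
  have hNR : (0 : ℝ) < N := by exact_mod_cast hN0
  have hnkR : (n : ℝ) ≤ k := by exact_mod_cast hnk
  have hknR : (k : ℝ) * n ≤ N := by exact_mod_cast hkn
  have hNkR : (N : ℝ) ≤ (k + 1) * n := by exact_mod_cast hNk.le
  have hNR2 : (n : ℝ) ^ 2 ≤ N := by exact_mod_cast hN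
  have hsq : (0 : ℝ) < √n := Real.sqrt_pos.2 (by linarith)
  have hss : √(n : ℝ) * √n = n := Real.mul_self_sqrt (by linarith)
  set M := ⌊c * N⌋₊
  set m₀ := ⌊c * n⌋₊
  have hM1 : (M : ℝ) ≤ c * N := Nat.floor_le (by positivity)
  have hM2 : c * N < M + 1 := Nat.lt_floor_add_one _
  have hm1 : (m₀ : ℝ) ≤ c * n := Nat.floor_le (by positivity)
  have hm2 : c * n < m₀ + 1 := Nat.lt_floor_add_one _
  have hMk : (M : ℝ) / k ≤ c * n + c := by
    rw [div_le_iff₀ hkR]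
    nlinarith [mul_le_mul_of_nonneg_left hNkR hc.le, mul_le_mul_of_nonneg_left hnkR hc.le]
  have hMk' : c * n - 1 ≤ (M : ℝ) / k := by
    have : (1 : ℝ) ≤ k := by exact_mod_cast hk0
    rw [le_div_iff₀ hkR]
    nlinarith [mul_le_mul_of_nonneg_left hknR hc.le]
  have hdev : ((M : ℝ) / k - m₀) ^ 2 ≤ (c + 1) ^ 2 := by
    refine sq_le_sq' ?_ ?_ <;> linarith
  have hmain := (card_mul_meanIndepNum_sub_le (J := Fin k) (W := Fin n) M m₀ hsq).trans
    (meanIndepNum_le_of_injective hinj M)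
  rw [Fintype.card_fin] at hmain
  set D : ℝ := ((c + 1) ^ 2 + 2 * c + 1) / 2 with hD
  have herr : (((M : ℝ) / k - m₀) ^ 2 + M / k) / (2 * √n) + √n / 2 ≤ D * √n := by
    have : ((M : ℝ) / k - m₀) ^ 2 + M / k ≤ ((c + 1) ^ 2 + 2 * c) * n := by
      nlinarith [sq_nonneg (c + 1)]
    have : (((M : ℝ) / k - m₀) ^ 2 + M / k) / (2 * √n) ≤ ((c + 1) ^ 2 + 2 * c) * √n / 2 := by
      rw [div_le_iff₀ (by positivity)]
      calc _ ≤ _ := this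
        _ = ((c + 1) ^ 2 + 2 * c) * √n / 2 * (2 * √n) := by
          nth_rewrite 1 [← hss]
          ring
    rw [hD]
    linarith
  set a := meanIndepNum (Fin n) m₀
  have ha : a ≤ n := by simpa using meanIndepNum_le_card (V := Fin n) m₀
  have hmain' : k * (a - D * √n) ≤ meanIndepNum (Fin N) M :=
    le_trans (mul_le_mul_of_nonneg_left (by linarith) hkR.le) hmain
  have hDn : D / √n = D * √n / n := by
    nth_rewrite 3 [← hss]
    field_simp
  have hlhs : a / n - D / √n - 1 / n = (a - D * √n - 1) / n := by rw [hDn]; ring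
  rw [hlhs, div_le_div_iff₀ (by linarith) hNR]
  have hmean : 0 ≤ meanIndepNum (Fin N) M := meanIndepNum_nonneg M
  have hDpos : 0 ≤ D * √n := by positivity
  rcases le_total (a - D * √n) 0 with h | h
  · have : (a - D * √n - 1) * N ≤ 0 := mul_nonpos_of_nonpos_of_nonneg (by linarith) hNR.le
    have : 0 ≤ meanIndepNum (Fin N) M * n := by positivity
    linarith
  · set b := a - D * √n
    have hb : b ≤ n := by linarith
    calc (b - 1) * N ≤ b * N - n ^ 2 := by linarith
      _ ≤ b * N - b * n := by nlinarith
      _ ≤ b * (k * n) := by nlinarith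
      _ = k * b * n := by ring
      _ ≤ meanIndepNum (Fin N) M * n := by gcongr

/-- A bounded sequence which is eventually at least each of its terms, up to an error
tending to zero with the index of the term, converges. -/
lemma exists_tendsto_of_eventually_sub_le {x δ : ℕ → ℝ} {a b : ℝ}
    (hx : ∀ n, x n ∈ Set.Icc a b) (hδ : Tendsto δ atTop (nhds 0))
    (h : ∀ᶠ n in atTop, ∀ᶠ N in atTop, x n - δ n ≤ x N) :
    ∃ H ∈ Set.Icc a b, Tendsto x atTop (nhds H) := by
  have hbdd : IsBoundedUnder (· ≤ ·) atTop x := isBoundedUnder_of ⟨b, fun n => (hx n).2⟩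
  have hbdd' : IsBoundedUnder (· ≥ ·) atTop x := isBoundedUnder_of ⟨a, fun n => (hx n).1⟩
  have hlim : Tendsto x atTop (nhds (limsup x atTop)) := by
    refine Metric.tendsto_nhds.2 fun ε hε => ?_
    have hup : ∀ᶠ n in atTop, x n < limsup x atTop + ε :=
      eventually_lt_of_limsup_lt (by linarith) hbdd
    have hfreq : ∃ᶠ n in atTop, limsup x atTop - ε / 2 < x n :=
      frequently_lt_of_lt_limsup hbdd'.isCoboundedUnder_le (by linarith)
    have hδ' : ∀ᶠ n in atTop, δ n < ε / 2 := hδ.eventually_lt_const (by linarith)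
    obtain ⟨n, hn, hδn, hnN⟩ := (hfreq.and_eventually (hδ'.and h)).exists
    filter_upwards [hup, hnN] with N h1 h2
    rw [Real.dist_eq, abs_lt]
    constructor <;> linarith
  exact ⟨_, isClosed_Icc.mem_of_tendsto hlim (Eventually.of_forall hx), hlim⟩

lemma exists_tendsto_meanIndepNum_div {c : ℝ} (hc : 0 < c) :
    ∃ H ∈ Set.Icc (0 : ℝ) 1,
      Tendsto (fun N : ℕ => meanIndepNum (Fin N) ⌊c * N⌋₊ / N) atTop (nhds H) := by
  refine exists_tendsto_of_eventually_sub_le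
    (δ := fun n => ((c + 1) ^ 2 + 2 * c + 1) / 2 / √n + 1 / n) (fun n => ?_) ?_ ?_
  · rcases Nat.eq_zero_or_pos n with rfl | hn
    · simp
    · have : Nonempty (Fin n) := ⟨⟨0, hn⟩⟩
      refine ⟨div_nonneg (meanIndepNum_nonneg _) (Nat.cast_nonneg _), ?_⟩
      exact div_le_one_of_le₀ (by simpa using meanIndepNum_le_card (V := Fin n) _)
        (Nat.cast_nonneg _)
  · have h1 : Tendsto (fun n : ℕ => ((c + 1) ^ 2 + 2 * c + 1) / 2 / √(n : ℝ)) atTop (nhds 0) :=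
      tendsto_const_nhds.div_atTop (Real.tendsto_sqrt_atTop.comp tendsto_natCast_atTop_atTop)
    simpa using h1.add tendsto_one_div_atTop_nhds_zero_nat
  · filter_upwards [eventually_gt_atTop 0] with n hn
    filter_upwards [eventually_ge_atTop (n ^ 2)] with N hN
    have := meanIndepNum_div_sub_le hc hn hN
    linarith

/-- For the Erdős–Rényi multigraph `G(N, ⌊cN⌋)`, the size of a largest independent set,
normalized by `N`, converges with high probability to a constant `H(c) ∈ [0,1]`. -/
theorem indep_set_scaling_limit_ER (c : ℝ) (hc : 0 < c) :
    ∃ H : ℝ, H ∈ Set.Icc (0 : ℝ) 1 ∧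
      ∀ ε : ℝ, 0 < ε →
        Tendsto (fun N : ℕ =>
            probER N ⌊c * (N : ℝ)⌋₊
              (fun E => ε < |(maxIndepER E : ℝ) / (N : ℝ) - H|))
          atTop (nhds 0) := by
  obtain ⟨H, hH, hlim⟩ := exists_tendsto_meanIndepNum_div hc
  refine ⟨H, hH, fun ε hε => ?_⟩
  have hbound : Tendsto (fun N : ℕ => 4 * c / ε ^ 2 / (N : ℝ)) atTop (nhds 0) :=
    tendsto_const_nhds.div_atTop tendsto_natCast_atTop_atTop
  refine squeeze_zero' (Eventually.of_forall fun N => by unfold probER; positivity) ?_ hbound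
  have hclose := Metric.tendsto_nhds.1 hlim (ε / 2) (by linarith)
  filter_upwards [hclose, eventually_gt_atTop 0] with N hN hN0
  have hNR : (0 : ℝ) < N := by exact_mod_cast hN0
  refine (probER_lt_abs_sub_meanIndepNum_le hN0 _ (t := ε / 2 * N) (by positivity)
    fun E hE => ?_).trans ?_
  · rw [Real.dist_eq] at hN
    set m := meanIndepNum (Fin N) ⌊c * N⌋₊
    have htri := abs_sub_le ((maxIndepER E : ℝ) / N) (m / N) H
    rw [← sub_div, abs_div, abs_of_pos hNR] at htri
    rw [← le_div_iff₀ hNR]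
    linarith
  · have hM : (⌊c * (N : ℝ)⌋₊ : ℝ) ≤ c * N := Nat.floor_le (by positivity)
    calc (⌊c * (N : ℝ)⌋₊ : ℝ) / (ε / 2 * N) ^ 2 ≤ c * N / (ε / 2 * N) ^ 2 := by gcongr
      _ = 4 * c / ε ^ 2 / N := by field_simp; norm_num
end

section
/- Fix real constants c > 0, β > 0 and B ∈ ℝ. For each N let G(N, ⌊cN⌋) be the Erdős–Rényi directed multigraph on [N] with edge list e_1,…,e_{⌊cN⌋}, and let H_N = max over x : [N] → {0,1} of Σ_{i∈[N]} h(x_i) + Σ_m g(x_{i_m}, x_{j_m}), where h(1)=B, h(0)=−B, g(a,b) = −β if a = b and g(a,b) = β if a ≠ b, and e_m = (i_m, j_m). Then there exists a constant H(c) such that H_N / N converges to H(c) with high probability as N → ∞. -/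
open Filter
open scoped Classical

/-- The antiferromagnetic Ising ground state value with parameters `β, B` of the edge
list `E`: the maximum over `x : Fin N → Bool` of the sum of node potentials
(`B` if `x i = true`, `-B` otherwise) plus the sum over edges of `-β` if the endpoint
values agree and `β` if they differ. -/
noncomputable def isingMax (β B : ℝ) {N M : ℕ} (E : Fin M → Fin N × Fin N) : ℝ :=
  ⨆ x : Fin N → Bool,
    ((∑ i : Fin N, if x i then B else -B) +
      ∑ m : Fin M, if x (E m).1 = x (E m).2 then -β else β)


namespace Ising

/-- Change of energy caused by an edge between `i` and `j`. -/
noncomputable def edgeEnergy (β : ℝ) {V : Type*} (i j : V) : (V → Bool) → ℝ :=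
  fun x => if x i = x j then -β else β

/-- The sum of the node potentials. -/
noncomputable def fieldEnergy (B : ℝ) (V : Type*) [Fintype V] : (V → Bool) → ℝ :=
  fun x => ∑ i, if x i then B else -B

/-- The maximum of an energy function. -/
noncomputable def top {X : Type*} (F : X → ℝ) : ℝ := ⨆ x, F x

/-- Translation by `f`, acting on functionals of the energy function. -/
noncomputable def shift {X : Type*} (f : X → ℝ) : Module.End ℝ ((X → ℝ) → ℝ) :=
  LinearMap.funLeft ℝ ℝ (fun F => F + f)

/-- Averaging over the addition of a uniformly random edge between two vertices in the
range of `φ`. -/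
noncomputable def avgEdge (β : ℝ) {W V : Type*} [Fintype W] (φ : W → V) :
    Module.End ℝ (((V → Bool) → ℝ) → ℝ) :=
  ((Fintype.card W : ℝ) ^ 2)⁻¹ • ∑ e : W × W, shift (edgeEnergy β (φ e.1) (φ e.2))

theorem shift_apply {X : Type*} (f : X → ℝ) (Φ : (X → ℝ) → ℝ) (F : X → ℝ) :
    shift f Φ F = Φ (F + f) := rfl

theorem shift_commute {X : Type*} (f g : X → ℝ) : Commute (shift f) (shift g) := by
  refine LinearMap.ext fun Φ => funext fun F => ?_
  change Φ (F + f + g) = Φ (F + g + f)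
  rw [add_right_comm]

theorem avgEdge_apply (β : ℝ) {W V : Type*} [Fintype W] (φ : W → V)
    (Φ : ((V → Bool) → ℝ) → ℝ) (F : (V → Bool) → ℝ) :
    avgEdge β φ Φ F = ((Fintype.card W : ℝ) ^ 2)⁻¹ *
      ∑ e : W × W, Φ (F + edgeEnergy β (φ e.1) (φ e.2)) := by
  simp [avgEdge, LinearMap.sum_apply, Finset.sum_apply, shift_apply]

theorem avgEdge_commute (β : ℝ) {W W' V : Type*} [Fintype W] [Fintype W'] (φ : W → V)
    (ψ : W' → V) : Commute (avgEdge β φ) (avgEdge β ψ) :=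
  ((Commute.sum_right _ _ _ fun _ _ => Commute.sum_left _ _ _ fun _ _ =>
    shift_commute _ _).smul_right _).smul_left _

theorem avgEdge_mono (β : ℝ) {W V : Type*} [Fintype W] (φ : W → V) :
    Monotone (avgEdge β φ) := by
  intro Φ Ψ h F
  simp only [avgEdge_apply]
  gcongr
  exact h _

theorem end_pow_mono {X : Type*} {T : Module.End ℝ (X → ℝ)} (hT : Monotone T) (k : ℕ) :
    Monotone (T ^ k : Module.End ℝ (X → ℝ)) := by
  induction k with
  | zero => exact fun _ _ h => h
  | succ k ih =>
    intro Φ Ψ h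
    rw [pow_succ]
    exact ih (hT h)

theorem pow_apply_le_pow_apply {X : Type*} {S T : Module.End ℝ (X → ℝ)} {Φ : X → ℝ}
    (hS : Monotone S) (hT : Monotone T) (hST : Commute S T) (h : S Φ ≤ T Φ) (k : ℕ) :
    (S ^ k : Module.End ℝ (X → ℝ)) Φ ≤ (T ^ k : Module.End ℝ (X → ℝ)) Φ := by
  induction k with
  | zero => exact le_rfl
  | succ k ih =>
    calc (S ^ (k + 1) : Module.End ℝ (X → ℝ)) Φ
        = (S ^ k : Module.End ℝ (X → ℝ)) (S Φ) := by rw [pow_succ]; rfl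
      _ ≤ (S ^ k : Module.End ℝ (X → ℝ)) (T Φ) := end_pow_mono hS k h
      _ = T ((S ^ k : Module.End ℝ (X → ℝ)) Φ) := by
          change (S ^ k * T) Φ = (T * S ^ k) Φ
          rw [(hST.pow_left k).eq]
      _ ≤ T ((T ^ k : Module.End ℝ (X → ℝ)) Φ) := hT ih
      _ = (T ^ (k + 1) : Module.End ℝ (X → ℝ)) Φ := by rw [pow_succ']; rfl

/-- Functionals that are `1`-Lipschitz for the sup norm. -/
def Lip {X : Type*} (Φ : (X → ℝ) → ℝ) : Prop :=
  ∀ (F G : X → ℝ) (D : ℝ), (∀ x, |F x - G x| ≤ D) → |Φ F - Φ G| ≤ D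

theorem le_top {X : Type*} [Finite X] (F : X → ℝ) (x : X) : F x ≤ top F :=
  le_ciSup (Set.finite_range F).bddAbove x

theorem top_le {X : Type*} [Nonempty X] {F : X → ℝ} {a : ℝ} (h : ∀ x, F x ≤ a) :
    top F ≤ a := ciSup_le h

theorem exists_top_eq {X : Type*} [Finite X] [Nonempty X] (F : X → ℝ) : ∃ x, F x = top F := by
  obtain ⟨x, hx⟩ := Finite.exists_max F
  exact ⟨x, le_antisymm (le_top F x) (top_le hx)⟩

theorem lip_top {X : Type*} [Finite X] [Nonempty X] : Lip (top : (X → ℝ) → ℝ) := by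
  intro F G D h
  rw [abs_le]
  constructor
  · have : top G ≤ top F + D := top_le fun x => by
      have := abs_le.1 (h x); have := le_top F x; linarith
    linarith
  · have : top F ≤ top G + D := top_le fun x => by
      have := abs_le.1 (h x); have := le_top G x; linarith
    linarith

theorem abs_edgeEnergy {β : ℝ} (hβ : 0 < β) {V : Type*} (i j : V) (x : V → Bool) :
    |edgeEnergy β i j x| = β := by
  unfold edgeEnergy
  split_ifs <;> simp [abs_of_pos hβ]

theorem avg_le {W : Type*} [Fintype W] [Nonempty W] {f : W × W → ℝ} {D : ℝ}
    (h : ∀ e, f e ≤ D) : ((Fintype.card W : ℝ) ^ 2)⁻¹ * ∑ e, f e ≤ D := by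
  have hW : (0 : ℝ) < Fintype.card W := by exact_mod_cast Fintype.card_pos
  rw [inv_mul_le_iff₀ (by positivity)]
  calc ∑ e, f e ≤ ∑ _e : W × W, D := Finset.sum_le_sum fun e _ => h e
    _ = _ := by simp [Fintype.card_prod, sq]

theorem avg_const (W : Type*) [Fintype W] [Nonempty W] (D : ℝ) :
    ((Fintype.card W : ℝ) ^ 2)⁻¹ * ∑ _e : W × W, D = D := by
  have hW : (0 : ℝ) < Fintype.card W := by exact_mod_cast Fintype.card_pos
  rw [Finset.sum_const, Finset.card_univ, Fintype.card_prod, nsmul_eq_mul]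
  push_cast
  field_simp

theorem abs_avg_le {W : Type*} [Fintype W] [Nonempty W] {f : W × W → ℝ} {D : ℝ}
    (h : ∀ e, |f e| ≤ D) : |((Fintype.card W : ℝ) ^ 2)⁻¹ * ∑ e, f e| ≤ D := by
  rw [abs_mul, abs_of_nonneg (by positivity)]
  refine le_trans ?_ (avg_le h)
  gcongr
  exact Finset.abs_sum_le_sum_abs _ _

theorem Lip.avgEdge {V W : Type*} [Fintype W] [Nonempty W] {Φ : ((V → Bool) → ℝ) → ℝ}
    (hΦ : Lip Φ) (β : ℝ) (φ : W → V) : Lip (avgEdge β φ Φ) := by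
  intro F G D h
  rw [avgEdge_apply, avgEdge_apply, ← mul_sub, ← Finset.sum_sub_distrib]
  exact abs_avg_le fun e => hΦ _ _ _ fun x => by simpa using h x

theorem Lip.avgEdge_pow {V W : Type*} [Fintype W] [Nonempty W] {Φ : ((V → Bool) → ℝ) → ℝ}
    (hΦ : Lip Φ) (β : ℝ) (φ : W → V) (k : ℕ) : Lip ((Ising.avgEdge β φ ^ k) Φ) := by
  induction k with
  | zero => exact hΦ
  | succ k ih =>
    rw [pow_succ']
    exact ih.avgEdge β φ

theorem Lip.abs_avgEdge_sub_le {V W : Type*} [Fintype W] [Nonempty W]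
    {Φ : ((V → Bool) → ℝ) → ℝ} (hΦ : Lip Φ) {β : ℝ} (hβ : 0 < β) (φ : W → V)
    (F : (V → Bool) → ℝ) : |Ising.avgEdge β φ Φ F - Φ F| ≤ β := by
  rw [avgEdge_apply]
  nth_rw 1 [← avg_const W (Φ F)]
  rw [← mul_sub, ← Finset.sum_sub_distrib]
  refine abs_avg_le fun e => hΦ _ _ _ fun x => ?_
  simp [abs_edgeEnergy hβ]

theorem Lip.avgEdge_sq_le {V W : Type*} [Fintype W] [Nonempty W]
    {Φ : ((V → Bool) → ℝ) → ℝ} (hΦ : Lip Φ) {β : ℝ} (hβ : 0 < β) (φ : W → V) :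
    Ising.avgEdge β φ (Φ ^ 2) ≤ (Ising.avgEdge β φ Φ) ^ 2 + fun _ => β ^ 2 := by
  intro F
  have h : ((Fintype.card W : ℝ) ^ 2)⁻¹ * ∑ e : W × W,
      (Φ (F + edgeEnergy β (φ e.1) (φ e.2)) - Φ F) ^ 2 ≤ β ^ 2 :=
    avg_le fun e => by
      rw [← sq_abs]
      gcongr
      refine hΦ _ _ _ fun x => ?_
      simp [abs_edgeEnergy hβ]
  have hc := avg_const W (Φ F ^ 2)
  simp only [Pi.add_apply, Pi.pow_apply, avgEdge_apply] at *
  simp only [sub_sq, Finset.sum_add_distrib, Finset.sum_sub_distrib, mul_add, mul_sub] at h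
  rw [hc] at h
  simp only [← Finset.sum_mul, ← Finset.mul_sum] at h
  nlinarith [sq_nonneg (((Fintype.card W : ℝ) ^ 2)⁻¹ *
    ∑ e : W × W, Φ (F + edgeEnergy β (φ e.1) (φ e.2)) - Φ F)]

theorem avgEdge_const {V W : Type*} [Fintype W] [Nonempty W] (β D : ℝ) (φ : W → V) (k : ℕ) :
    (avgEdge β φ ^ k) (fun _ => D) = fun _ => D := by
  induction k with
  | zero => rfl
  | succ k ih =>
    rw [pow_succ, Module.End.mul_apply]
    have : avgEdge β φ (fun _ => D) = fun _ => D := by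
      funext F
      rw [avgEdge_apply, avg_const]
    rw [this, ih]

theorem Lip.avgEdge_pow_sq_le {V W : Type*} [Fintype W] [Nonempty W]
    {Φ : ((V → Bool) → ℝ) → ℝ} (hΦ : Lip Φ) {β : ℝ} (hβ : 0 < β) (φ : W → V) (k : ℕ)
    (F : (V → Bool) → ℝ) :
    (Ising.avgEdge β φ ^ k) (Φ ^ 2) F ≤ ((Ising.avgEdge β φ ^ k) Φ F) ^ 2 + k * β ^ 2 := by
  induction k generalizing Φ with
  | zero => simp
  | succ k ih =>
    have h := end_pow_mono (avgEdge_mono β φ) k (hΦ.avgEdge_sq_le hβ φ) F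
    rw [map_add, avgEdge_const] at h
    have h2 := ih (hΦ.avgEdge β φ)
    rw [pow_succ, Module.End.mul_apply, Module.End.mul_apply]
    simp only [Pi.add_apply] at h
    push_cast
    linarith

theorem avgEdge_pow_apply {V : Type*} [Fintype V] (β : ℝ) (Φ : ((V → Bool) → ℝ) → ℝ)
    (k : ℕ) (F : (V → Bool) → ℝ) :
    (avgEdge β (id : V → V) ^ k) Φ F = (((Fintype.card V : ℝ) ^ 2) ^ k)⁻¹ *
      ∑ E : Fin k → V × V, Φ (F + ∑ m, edgeEnergy β (E m).1 (E m).2) := by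
  induction k generalizing F with
  | zero => simp
  | succ k ih =>
    rw [pow_succ', Module.End.mul_apply, avgEdge_apply]
    simp only [ih, id]
    rw [← Finset.mul_sum, ← mul_assoc, ← mul_inv, ← pow_succ',
      ← (Fin.consEquiv fun _ : Fin (k + 1) => V × V).sum_comp]
    simp [Fin.sum_univ_succ, Fin.consEquiv, add_assoc, Fintype.sum_prod_type]

theorem sum_same_color {W C : Type*} [Fintype W] [Fintype C] (κ : W → C) :
    (∑ e : W × W, if κ e.1 = κ e.2 then (1 : ℝ) else 0) =
      ∑ q, (∑ i, if κ i = q then (1 : ℝ) else 0) ^ 2 := by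
  simp only [sq, Finset.sum_mul_sum, Fintype.sum_prod_type]
  rw [Finset.sum_comm' (t' := Finset.univ) (s' := fun _ => Finset.univ) (by simp)]
  rw [Finset.sum_comm]
  simp only [mul_ite, mul_one, mul_zero, ← ite_and]
  rw [Finset.sum_comm (s := (Finset.univ : Finset C))]
  refine Finset.sum_congr rfl fun i _ => ?_
  rw [Finset.sum_comm]
  refine Finset.sum_congr rfl fun j _ => ?_
  by_cases h : κ i = κ j
  · simp [h]
  · rw [if_neg h, Finset.sum_eq_zero]
    rintro q -
    rw [if_neg]
    rintro ⟨rfl, h2⟩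
    exact h h2

/-- Two random points of a union of blocks share a color with at most the probability that two
random points of a random block do, blocks being chosen proportionally to their sizes. -/
theorem same_color_block_le {ι C : Type*} [Fintype ι] [Fintype C] {W : ι → Type*}
    [∀ b, Fintype (W b)] [∀ b, Nonempty (W b)] (κ : (Σ b, W b) → C) :
    (∑ e : (Σ b, W b) × (Σ b, W b), if κ e.1 = κ e.2 then (1 : ℝ) else 0) /
        Fintype.card (Σ b, W b) ≤
      ∑ b, (∑ e : W b × W b, if κ ⟨b, e.1⟩ = κ ⟨b, e.2⟩ then (1 : ℝ) else 0) /
        Fintype.card (W b) := by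
  rw [sum_same_color κ, Finset.sum_div]
  simp_rw [fun b => sum_same_color fun i : W b => κ ⟨b, i⟩, Finset.sum_div]
  rw [Finset.sum_comm]
  refine Finset.sum_le_sum fun q _ => ?_
  rw [Fintype.sum_sigma, Fintype.card_sigma, Nat.cast_sum]
  exact Finset.sq_sum_div_le_sum_sq_div _ _ fun b _ => by exact_mod_cast Fintype.card_pos

/-- The gap between the largest conceivable and the actual maximum after adding an edge. -/
noncomputable def edgeGap (β : ℝ) {V : Type*} (F : (V → Bool) → ℝ) (i j : V) : ℝ :=
  top F + β - top (F + edgeEnergy β i j)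

/-- Vertices have the same color when they agree in all configurations that are within `s` of
the maximum. -/
noncomputable def nearTopColor {V : Type*} (F : (V → Bool) → ℝ) (s : ℝ) (i : V) :
    (V → Bool) → Bool :=
  fun x => if top F - s < F x then x i else false

theorem le_edgeGap_iff {β : ℝ} {V : Type*} [Finite V] {F : (V → Bool) → ℝ}
    {i j : V} {s : ℝ} (hs : s ≤ 2 * β) :
    s ≤ edgeGap β F i j ↔ nearTopColor F s i = nearTopColor F s j := by
  have key : s ≤ edgeGap β F i j ↔ ∀ x, F x + edgeEnergy β i j x ≤ top F + β - s := by
    unfold edgeGap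
    constructor
    · intro h x
      have := le_top (F + edgeEnergy β i j) x
      simp only [Pi.add_apply] at this
      linarith
    · intro h
      have := top_le (F := F + edgeEnergy β i j) h
      linarith
  rw [key, funext_iff]
  refine forall_congr' fun x => ?_
  have := le_top F x
  unfold edgeEnergy nearTopColor
  by_cases hx : x i = x j
  · simp only [hx, if_true, iff_true]
    linarith
  · rw [if_neg hx]
    by_cases h : top F - s < F x
    · simp only [h, if_true, hx, iff_false]
      linarith
    · simp only [h, if_false, iff_true]
      linarith

theorem edgeGap_mem {β : ℝ} (hβ : 0 < β) {V : Type*} [Finite V] (F : (V → Bool) → ℝ)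
    (i j : V) : edgeGap β F i j ∈ Set.Icc 0 (2 * β) := by
  have h := abs_le.1 (lip_top (F + edgeEnergy β i j) F β fun x => by
    simp [abs_edgeEnergy hβ])
  unfold edgeGap
  constructor <;> linarith [h.1, h.2]

theorem integral_ite_le {k a : ℝ} (hk : k ∈ Set.Icc 0 a) :
    ∫ s in (0 : ℝ)..a, (if s ≤ k then (1 : ℝ) else 0) = k := by
  have h := intervalIntegral.integral_indicator (μ := MeasureTheory.volume)
    (f := fun _ : ℝ => (1 : ℝ)) hk
  simpa [Set.indicator] using h

theorem intervalIntegrable_ite_le (k a b : ℝ) :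
    IntervalIntegrable (fun s : ℝ => if s ≤ k then (1 : ℝ) else 0)
      MeasureTheory.volume a b := by
  refine Antitone.intervalIntegrable fun s t hst => ?_
  split_ifs with h1 h2
  · exact le_rfl
  · exact absurd (hst.trans h1) h2
  · exact zero_le_one
  · exact le_rfl

theorem intervalIntegrable_sum_ite_le {α : Type*} [Fintype α] (k : α → ℝ) (D a b : ℝ) :
    IntervalIntegrable (fun s : ℝ => (∑ e, if s ≤ k e then (1 : ℝ) else 0) / D)
      MeasureTheory.volume a b := by
  refine IntervalIntegrable.div_const ?_ D
  have h := IntervalIntegrable.sum (f := fun e s => if s ≤ k e then (1 : ℝ) else 0)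
    Finset.univ fun e _ => intervalIntegrable_ite_le (k e) a b
  exact h.congr fun s _ => Finset.sum_apply _ _ _

theorem integral_sum_ite_le {α : Type*} [Fintype α] {k : α → ℝ} {a : ℝ} (D : ℝ)
    (hk : ∀ e, k e ∈ Set.Icc 0 a) :
    ∫ s in (0 : ℝ)..a, (∑ e, if s ≤ k e then (1 : ℝ) else 0) / D = (∑ e, k e) / D := by
  rw [intervalIntegral.integral_div, intervalIntegral.integral_finsetSum
    fun e _ => intervalIntegrable_ite_le (k e) _ _]
  simp_rw [fun e => integral_ite_le (hk e)]

theorem sum_edgeGap_le {β : ℝ} (hβ : 0 < β) {ι : Type*} [Fintype ι] {W : ι → Type*}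
    [∀ b, Fintype (W b)] [∀ b, Nonempty (W b)] (F : ((Σ b, W b) → Bool) → ℝ) :
    (∑ e : (Σ b, W b) × (Σ b, W b), edgeGap β F e.1 e.2) / Fintype.card (Σ b, W b) ≤
      ∑ b, (∑ e : W b × W b, edgeGap β F ⟨b, e.1⟩ ⟨b, e.2⟩) / Fintype.card (W b) := by
  have hint := fun b => intervalIntegrable_sum_ite_le
    (fun e : W b × W b => edgeGap β F ⟨b, e.1⟩ ⟨b, e.2⟩) (Fintype.card (W b)) 0 (2 * β)
  have hsum := IntervalIntegrable.sum Finset.univ fun b _ => hint b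
  rw [← integral_sum_ite_le (k := fun e : (Σ b, W b) × (Σ b, W b) => edgeGap β F e.1 e.2) _
    fun e => edgeGap_mem hβ F e.1 e.2]
  simp_rw [fun b => (integral_sum_ite_le
    (k := fun e : W b × W b => edgeGap β F ⟨b, e.1⟩ ⟨b, e.2⟩) (Fintype.card (W b))
    fun e => edgeGap_mem hβ F _ _).symm]
  rw [← intervalIntegral.integral_finsetSum fun b _ => hint b]
  refine intervalIntegral.integral_mono_on (by positivity)
    (intervalIntegrable_sum_ite_le _ _ _ _) ?_ fun s hs => ?_
  · exact hsum.congr fun s _ => Finset.sum_apply _ _ _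
  · have h := same_color_block_le (nearTopColor F s)
    simp only [← le_edgeGap_iff hs.2] at h
    convert h

/-- Averaging over the addition of a random edge inside a random block, blocks being chosen
proportionally to their sizes. -/
noncomputable def avgBlockEdge (β : ℝ) {ι : Type*} [Fintype ι] (W : ι → Type*)
    [∀ b, Fintype (W b)] : Module.End ℝ ((((Σ b, W b) → Bool) → ℝ) → ℝ) :=
  ∑ b, ((Fintype.card (W b) : ℝ) / Fintype.card (Σ b, W b)) • avgEdge β (Sigma.mk b)

theorem avgBlockEdge_apply (β : ℝ) {ι : Type*} [Fintype ι] (W : ι → Type*)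
    [∀ b, Fintype (W b)] (Φ : (((Σ b, W b) → Bool) → ℝ) → ℝ) (F : ((Σ b, W b) → Bool) → ℝ) :
    avgBlockEdge β W Φ F = ∑ b, ((Fintype.card (W b) : ℝ) / Fintype.card (Σ b, W b)) *
      avgEdge β (Sigma.mk b) Φ F := by
  simp [avgBlockEdge, LinearMap.sum_apply, Finset.sum_apply]

theorem avgBlockEdge_mono (β : ℝ) {ι : Type*} [Fintype ι] (W : ι → Type*)
    [∀ b, Fintype (W b)] : Monotone (avgBlockEdge β W) := by
  intro Φ Ψ h F
  simp only [avgBlockEdge_apply]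
  gcongr with b
  exact avgEdge_mono β _ h F

theorem avgEdge_top {V W : Type*} [Fintype W] [Nonempty W] (β : ℝ) (φ : W → V)
    (F : (V → Bool) → ℝ) : avgEdge β φ top F = top F + β -
      ((Fintype.card W : ℝ) ^ 2)⁻¹ * ∑ e : W × W, edgeGap β F (φ e.1) (φ e.2) := by
  simp only [edgeGap]
  rw [avgEdge_apply, Finset.sum_sub_distrib, mul_sub, avg_const]
  ring

theorem sum_card_div_card {ι : Type*} [Fintype ι] [Nonempty ι] (W : ι → Type*)
    [∀ b, Fintype (W b)] [∀ b, Nonempty (W b)] :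
    ∑ b, (Fintype.card (W b) : ℝ) / Fintype.card (Σ b, W b) = 1 := by
  have : Nonempty (Σ b, W b) := nonempty_sigma.2 ⟨Classical.arbitrary ι, inferInstance⟩
  have h : (0 : ℝ) < Fintype.card (Σ b, W b) := by exact_mod_cast Fintype.card_pos
  rw [← Finset.sum_div, div_eq_one_iff_eq h.ne', Fintype.card_sigma, Nat.cast_sum]

theorem avgBlockEdge_top_le {β : ℝ} (hβ : 0 < β) {ι : Type*} [Fintype ι] [Nonempty ι]
    (W : ι → Type*) [∀ b, Fintype (W b)] [∀ b, Nonempty (W b)] :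
    avgBlockEdge β W top ≤ avgEdge β id top := by
  intro F
  have : Nonempty (Σ b, W b) := nonempty_sigma.2 ⟨Classical.arbitrary ι, inferInstance⟩
  have hN : (0 : ℝ) < Fintype.card (Σ b, W b) := by exact_mod_cast Fintype.card_pos
  rw [avgBlockEdge_apply, avgEdge_top]
  simp_rw [avgEdge_top, mul_sub, Finset.sum_sub_distrib]
  rw [← Finset.sum_mul, sum_card_div_card, one_mul]
  refine sub_le_sub_left ?_ _
  calc _ = (∑ e : (Σ b, W b) × (Σ b, W b), edgeGap β F e.1 e.2) /
        Fintype.card (Σ b, W b) / Fintype.card (Σ b, W b) := by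
        rw [div_div, ← sq, div_eq_inv_mul]
        rfl
    _ ≤ _ := div_le_div_of_nonneg_right (sum_edgeGap_le hβ F) hN.le
    _ = _ := by
        rw [Finset.sum_div]
        refine Finset.sum_congr rfl fun b _ => ?_
        have hb : (0 : ℝ) < Fintype.card (W b) := by exact_mod_cast Fintype.card_pos
        generalize ∑ e : W b × W b, edgeGap β F ⟨b, e.1⟩ ⟨b, e.2⟩ = s
        field_simp

theorem avgBlockEdge_pow_top_le {β : ℝ} (hβ : 0 < β) {ι : Type*} [Fintype ι] [Nonempty ι]
    (W : ι → Type*) [∀ b, Fintype (W b)] [∀ b, Nonempty (W b)] (k : ℕ) :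
    (avgBlockEdge β W ^ k) top ≤ (avgEdge β id ^ k) top :=
  pow_apply_le_pow_apply (avgBlockEdge_mono β W) (avgEdge_mono β _)
    (Commute.sum_left _ _ _ fun _ _ => (avgEdge_commute β _ _).smul_left _)
    (avgBlockEdge_top_le hβ W) k

/-- The energy function on a union of blocks that has no interaction between the blocks. -/
noncomputable def blockEnergy {ι : Type*} [Fintype ι] {W : ι → Type*}
    (f : ∀ b, (W b → Bool) → ℝ) : ((Σ b, W b) → Bool) → ℝ :=
  fun x => ∑ b, f b fun i => x ⟨b, i⟩

theorem top_blockEnergy {ι : Type*} [Fintype ι] {W : ι → Type*} [∀ b, Fintype (W b)]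
    (f : ∀ b, (W b → Bool) → ℝ) : top (blockEnergy f) = ∑ b, top (f b) := by
  apply le_antisymm
  · exact top_le fun x => Finset.sum_le_sum fun b _ => le_top _ _
  · choose x hx using fun b => exists_top_eq (f b)
    simp_rw [← hx]
    exact le_top (blockEnergy f) fun v => x v.1 v.2

theorem sum_apply_update {ι : Type*} [Fintype ι] {X : ι → Type*} (G : ∀ b, X b → ℝ)
    (f : ∀ b, X b) (b : ι) (v : X b) :
    ∑ b', G b' (Function.update f b v b') = ∑ b', G b' (f b') + (G b v - G b (f b)) := by
  rw [← Finset.add_sum_erase _ _ (Finset.mem_univ b),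
    ← Finset.add_sum_erase _ (fun b' => G b' (f b')) (Finset.mem_univ b)]
  have h : ∑ b' ∈ Finset.univ.erase b, G b' (Function.update f b v b') =
      ∑ b' ∈ Finset.univ.erase b, G b' (f b') := Finset.sum_congr rfl fun b' hb' => by
    rw [Function.update_of_ne (Finset.ne_of_mem_erase hb')]
  rw [h, Function.update_self]
  ring

theorem blockEnergy_add_edgeEnergy {ι : Type*} [Fintype ι] {W : ι → Type*} (β : ℝ)
    (f : ∀ b, (W b → Bool) → ℝ) (b : ι) (i j : W b) :
    blockEnergy f + edgeEnergy β ⟨b, i⟩ ⟨b, j⟩ =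
      blockEnergy (Function.update f b (f b + edgeEnergy β i j)) := by
  funext x
  have h := sum_apply_update (fun b g => g fun i => x ⟨b, i⟩) f b (f b + edgeEnergy β i j)
  simp only [blockEnergy, Pi.add_apply] at h ⊢
  rw [h]
  simp only [edgeEnergy]
  ring

/-- Performing the operation `T` with probability `p`. -/
noncomputable def lazyOp {X : Type*} (p : ℝ) (T : Module.End ℝ (X → ℝ)) :
    Module.End ℝ (X → ℝ) := (1 - p) • 1 + p • T

theorem lazyOp_apply {X : Type*} (p : ℝ) (T : Module.End ℝ (X → ℝ)) (Φ : X → ℝ) (F : X) :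
    lazyOp p T Φ F = (1 - p) * Φ F + p * T Φ F := by
  simp [lazyOp]

theorem avgBlockEdge_pow_top (β : ℝ) {ι : Type*} [Fintype ι] [Nonempty ι]
    (W : ι → Type*) [∀ b, Fintype (W b)] [∀ b, Nonempty (W b)] (k : ℕ)
    (f : ∀ b, (W b → Bool) → ℝ) :
    (avgBlockEdge β W ^ k) top (blockEnergy f) =
      ∑ b, (lazyOp ((Fintype.card (W b) : ℝ) / Fintype.card (Σ b, W b))
        (avgEdge β (id : W b → W b)) ^ k) top (f b) := by
  induction k generalizing f with
  | zero => exact top_blockEnergy f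
  | succ k ih =>
    set G : ∀ b, ((W b → Bool) → ℝ) → ℝ := fun b =>
      (lazyOp ((Fintype.card (W b) : ℝ) / Fintype.card (Σ b, W b))
        (avgEdge β (id : W b → W b)) ^ k) top with hG
    have hb : ∀ b, avgEdge β (Sigma.mk b) ((avgBlockEdge β W ^ k) top) (blockEnergy f) =
        ∑ b', G b' (f b') + (avgEdge β id (G b) (f b) - G b (f b)) := by
      intro b
      rw [avgEdge_apply, avgEdge_apply]
      simp_rw [blockEnergy_add_edgeEnergy, ih]
      have h := fun v => sum_apply_update G f b v
      simp only [hG] at h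
      simp_rw [h]
      rw [Finset.sum_add_distrib, Finset.sum_sub_distrib, mul_add, mul_sub, avg_const, avg_const]
      rfl
    rw [pow_succ', Module.End.mul_apply, avgBlockEdge_apply]
    simp_rw [hb, mul_add, Finset.sum_add_distrib]
    rw [← Finset.sum_mul, sum_card_div_card, one_mul, ← Finset.sum_add_distrib]
    refine Finset.sum_congr rfl fun b _ => ?_
    rw [pow_succ', Module.End.mul_apply, lazyOp_apply]
    ring

theorem Lip.abs_avgEdge_pow_sub_le {V W : Type*} [Fintype W] [Nonempty W]
    {Φ : ((V → Bool) → ℝ) → ℝ} (hΦ : Lip Φ) {β : ℝ} (hβ : 0 < β) (φ : W → V)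
    (F : (V → Bool) → ℝ) (k j : ℕ) :
    |(Ising.avgEdge β φ ^ (k + j)) Φ F - (Ising.avgEdge β φ ^ k) Φ F| ≤ β * j := by
  induction j with
  | zero => simp
  | succ j ih =>
    have h := (hΦ.avgEdge_pow β φ (k + j)).abs_avgEdge_sub_le hβ φ F
    rw [← Module.End.mul_apply, ← pow_succ'] at h
    have := abs_sub_le ((Ising.avgEdge β φ ^ (k + (j + 1))) Φ F)
      ((Ising.avgEdge β φ ^ (k + j)) Φ F) ((Ising.avgEdge β φ ^ k) Φ F)
    push_cast
    rw [← add_assoc] at this ⊢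
    linarith

/-- A lazy power evaluates near its mean number of steps, up to the typical fluctuations. -/
theorem lazyOp_pow_ge {V W : Type*} [Fintype W] [Nonempty W] {Φ : ((V → Bool) → ℝ) → ℝ}
    (hΦ : Lip Φ) {β : ℝ} (hβ : 0 < β) (φ : W → V) {p δ : ℝ} (hp0 : 0 ≤ p) (hp1 : p ≤ 1)
    (hδ : 0 < δ) (m M : ℕ) (F : (V → Bool) → ℝ) :
    (avgEdge β φ ^ m) Φ F - β * (((p * M - m) ^ 2 + p * M) / (2 * δ) + δ / 2) ≤
      (lazyOp p (avgEdge β φ) ^ M) Φ F := by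
  have hstep := fun k j => hΦ.abs_avgEdge_pow_sub_le hβ φ F k j
  have hlip : ∀ k : ℕ, (avgEdge β φ ^ m) Φ F - β * |(k : ℝ) - m| ≤ (avgEdge β φ ^ k) Φ F := by
    intro k
    rcases le_total m k with h | h
    · obtain ⟨j, rfl⟩ := Nat.exists_eq_add_of_le h
      have := abs_le.1 (hstep m j)
      rw [show ((m + j : ℕ) : ℝ) - m = j by push_cast; ring, abs_of_nonneg (by positivity)]
      linarith
    · obtain ⟨j, rfl⟩ := Nat.exists_eq_add_of_le h
      have := abs_le.1 (hstep k j)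
      rw [show (k : ℝ) - (k + j : ℕ) = -j by push_cast; ring, abs_neg,
        abs_of_nonneg (by positivity)]
      linarith
  have hquad : ∀ u : ℝ, |u| ≤ u ^ 2 / (2 * δ) + δ / 2 := by
    intro u
    rw [← sq_abs u, div_add_div _ _ (by positivity) (by positivity), le_div_iff₀ (by positivity)]
    nlinarith [sq_nonneg (|u| - δ)]
  have main : ∀ M k : ℕ, (avgEdge β φ ^ m) Φ F -
      β * (((k + p * M - m) ^ 2 + p * (1 - p) * M) / (2 * δ) + δ / 2) ≤
        (lazyOp p (avgEdge β φ) ^ M) ((avgEdge β φ ^ k) Φ) F := by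
    intro M
    induction M with
    | zero =>
      intro k
      have h1 := hlip k
      have h2 := mul_le_mul_of_nonneg_left (hquad (k - m)) hβ.le
      simp only [pow_zero, Module.End.one_apply, Nat.cast_zero, mul_zero, add_zero]
      linarith
    | succ M ih =>
      intro k
      have h1 : lazyOp p (avgEdge β φ) ((avgEdge β φ ^ k) Φ) =
          (1 - p) • (avgEdge β φ ^ k) Φ + p • (avgEdge β φ ^ (k + 1)) Φ := by
        rw [pow_succ']
        rfl
      rw [pow_succ (lazyOp p (avgEdge β φ)), Module.End.mul_apply, h1, map_add, map_smul, map_smul]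
      have h2 := mul_le_mul_of_nonneg_left (ih k) (sub_nonneg.2 hp1)
      have h3 := mul_le_mul_of_nonneg_left (ih (k + 1)) hp0
      simp only [Pi.add_apply, Pi.smul_apply, smul_eq_mul]
      refine le_trans (le_of_eq ?_) (add_le_add h2 h3)
      push_cast
      field_simp
      ring
  refine le_trans ?_ (main M 0)
  simp only [Nat.cast_zero, zero_add]
  gcongr
  nlinarith [mul_nonneg (mul_nonneg hp0 hp0) (Nat.cast_nonneg (α := ℝ) M)]

/-- The expected ground state value with `M` random edges on the vertex set `V`. -/
noncomputable def meanTop (β B : ℝ) (V : Type*) [Fintype V] (M : ℕ) : ℝ :=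
  (avgEdge β (id : V → V) ^ M) top (fieldEnergy B V)

theorem avgEdge_pow_top_congr (β : ℝ) {V V' : Type*} [Fintype V] [Fintype V'] (e : V ≃ V')
    (M : ℕ) (F : (V → Bool) → ℝ) :
    (avgEdge β (id : V' → V') ^ M) top (fun x => F fun v => x (e v)) =
      (avgEdge β (id : V → V) ^ M) top F := by
  induction M generalizing F with
  | zero => exact (e.arrowCongr (Equiv.refl Bool)).symm.iSup_congr fun x => rfl
  | succ M ih =>
    rw [pow_succ', pow_succ', Module.End.mul_apply, Module.End.mul_apply, avgEdge_apply,
      avgEdge_apply, Fintype.card_congr e, ← (e.prodCongr e).sum_comp]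
    simp_rw [← ih]
    rfl

theorem meanTop_congr (β B : ℝ) {V V' : Type*} [Fintype V] [Fintype V'] (e : V ≃ V')
    (M : ℕ) : meanTop β B V M = meanTop β B V' M := by
  unfold meanTop
  rw [← avgEdge_pow_top_congr β e]
  refine congrArg _ (funext fun x => ?_)
  exact e.sum_comp fun v => if x v then B else -B

theorem abs_meanTop_le {β : ℝ} (hβ : 0 < β) (B : ℝ) (V : Type*) [Fintype V] [Nonempty V]
    (M : ℕ) : |meanTop β B V M| ≤ |B| * Fintype.card V + β * M := by
  have h1 := lip_top.abs_avgEdge_pow_sub_le hβ id (fieldEnergy B V) 0 M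
  have h2 : |top (fieldEnergy B V)| ≤ |B| * Fintype.card V := by
    obtain ⟨x, hx⟩ := exists_top_eq (fieldEnergy B V)
    rw [← hx]
    refine (Finset.abs_sum_le_sum_abs _ _).trans ?_
    have : ∀ i : V, |if x i then B else -B| = |B| := fun i => by split_ifs <;> simp
    simp [this, mul_comm]
  rw [zero_add, pow_zero, Module.End.one_apply] at h1
  have h3 := abs_add_le (meanTop β B V M - top (fieldEnergy B V)) (top (fieldEnergy B V))
  rw [sub_add_cancel] at h3
  exact h3.trans (by rw [add_comm]; exact add_le_add h2 h1)

theorem sum_meanTop_le {β : ℝ} (hβ : 0 < β) (B : ℝ) {ι : Type*} [Fintype ι] [Nonempty ι]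
    (W : ι → Type*) [∀ b, Fintype (W b)] [∀ b, Nonempty (W b)] (M : ℕ) (m : ι → ℕ)
    {δ : ι → ℝ} (hδ : ∀ b, 0 < δ b) :
    ∑ b, (meanTop β B (W b) (m b) - β *
      ((((Fintype.card (W b) : ℝ) / Fintype.card (Σ b, W b) * M - m b) ^ 2 +
        (Fintype.card (W b) : ℝ) / Fintype.card (Σ b, W b) * M) / (2 * δ b) + δ b / 2)) ≤
      meanTop β B (Σ b, W b) M := by
  have hfield : fieldEnergy B (Σ b, W b) = blockEnergy fun b => fieldEnergy B (W b) := by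
    funext x
    simp [fieldEnergy, blockEnergy, Fintype.sum_sigma]
  unfold meanTop
  rw [hfield]
  refine le_trans ?_ (avgBlockEdge_pow_top_le hβ W M _)
  rw [avgBlockEdge_pow_top]
  refine Finset.sum_le_sum fun b _ => ?_
  refine lazyOp_pow_ge lip_top hβ _ (by positivity) ?_ (hδ b) (m b) M _
  rw [← sum_card_div_card W]
  exact Finset.single_le_sum (f := fun b => (Fintype.card (W b) : ℝ) / Fintype.card (Σ b, W b))
    (fun b _ => by positivity) (Finset.mem_univ b)

/-- The expected ground state value of the Erdős–Rényi multigraph `G(N, ⌊cN⌋)`. -/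
noncomputable def meanER (c β B : ℝ) (N : ℕ) : ℝ := meanTop β B (Fin N) ⌊c * (N : ℝ)⌋₊

theorem abs_meanER_le {c β : ℝ} (hc : 0 < c) (hβ : 0 < β) (B : ℝ) {N : ℕ} (hN : 0 < N) :
    |meanER c β B N| ≤ (|B| + β * c) * N := by
  have : Nonempty (Fin N) := ⟨⟨0, hN⟩⟩
  have h := abs_meanTop_le hβ B (Fin N) ⌊c * (N : ℝ)⌋₊
  have h2 : (⌊c * (N : ℝ)⌋₊ : ℝ) ≤ c * N := Nat.floor_le (by positivity)
  rw [Fintype.card_fin] at h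
  unfold meanER
  nlinarith

theorem sum_meanER_le {c β : ℝ} (hc : 0 < c) (hβ : 0 < β) (B : ℝ) {ι : Type*} [Fintype ι]
    [Nonempty ι] (n : ι → ℕ) (hn : ∀ b, 0 < n b) :
    ∑ b, (meanER c β B (n b) - β * (2 + c) / 2 * √(n b)) ≤ meanER c β B (∑ b, n b) := by
  have : ∀ b, Nonempty (Fin (n b)) := fun b => ⟨⟨0, hn b⟩⟩
  have hn' : ∀ b, (1 : ℝ) ≤ n b := fun b => by exact_mod_cast hn b
  have hcard : Fintype.card (Σ b, Fin (n b)) = ∑ b, n b := by simp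
  have h := sum_meanTop_le hβ B (fun b => Fin (n b)) ⌊c * ((∑ b, n b : ℕ) : ℝ)⌋₊
    (fun b => ⌊c * (n b : ℝ)⌋₊) (δ := fun b => √(n b))
    (fun b => Real.sqrt_pos.2 (by linarith [hn' b]))
  rw [meanTop_congr β B (Fintype.equivFinOfCardEq hcard)] at h
  refine le_trans (Finset.sum_le_sum fun b _ => ?_) h
  rw [hcard, Fintype.card_fin]
  refine sub_le_sub_left ?_ _
  rw [mul_div_assoc, mul_assoc]
  refine mul_le_mul_of_nonneg_left ?_ hβ.le
  have hb := hn' b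
  have hle : (n b : ℝ) ≤ (∑ b, n b : ℕ) := by
    exact_mod_cast Finset.single_le_sum (f := n) (fun _ _ => Nat.zero_le _) (Finset.mem_univ b)
  generalize ((∑ b, n b : ℕ) : ℝ) = N at *
  generalize (n b : ℝ) = k at *
  have hN : 0 < N := by linarith
  have f1 : (⌊c * N⌋₊ : ℝ) ≤ c * N := Nat.floor_le (by positivity)
  have f2 := Nat.lt_floor_add_one (c * N)
  have f3 : (⌊c * k⌋₊ : ℝ) ≤ c * k := Nat.floor_le (by positivity)
  have f4 := Nat.lt_floor_add_one (c * k)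
  have g1 : k / N * ⌊c * N⌋₊ ≤ c * k := by
    rw [div_mul_eq_mul_div, div_le_iff₀ hN]
    nlinarith
  have g2 : c * k - 1 ≤ k / N * ⌊c * N⌋₊ := by
    rw [div_mul_eq_mul_div, le_div_iff₀ hN]
    nlinarith
  have g3 : (k / N * ⌊c * N⌋₊ - ⌊c * k⌋₊) ^ 2 ≤ 1 := by
    rw [sq_le_one_iff_abs_le_one, abs_le]
    constructor <;> linarith
  have hs : 0 < √k := Real.sqrt_pos.2 (by linarith)
  have hs2 : √k ^ 2 = k := Real.sq_sqrt (by linarith)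
  rw [div_add_div _ _ (by positivity) (by positivity), div_le_iff₀ (by positivity)]
  nlinarith

theorem meanER_mul_add_ge {c β : ℝ} (hc : 0 < c) (hβ : 0 < β) (B : ℝ) {n r : ℕ} (q : ℕ)
    (hn : 0 < n) (hr : 0 < r) :
    q * (meanER c β B n - β * (2 + c) / 2 * √n) + (meanER c β B r - β * (2 + c) / 2 * √r) ≤
      meanER c β B (q * n + r) := by
  have h := sum_meanER_le hc hβ B (fun o : Option (Fin q) => o.elim r fun _ => n)
    (by rintro (_ | _) <;> assumption)
  simp only [Fintype.sum_option, Option.elim, Finset.sum_const, Finset.card_univ,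
    Fintype.card_fin, nsmul_eq_mul, smul_eq_mul] at h
  rw [add_comm, add_comm (q * n)]
  exact h

/-- Near-superadditive sequences of linear growth have a linear rate. -/
theorem exists_tendsto_div_of_mul_add_ge {a : ℕ → ℝ} {C D : ℝ} (hC : 0 ≤ C)
    (hD : ∀ n, 0 < n → |a n| ≤ D * n)
    (h : ∀ q n r : ℕ, 0 < n → 0 < r →
      q * (a n - C * √n) + (a r - C * √r) ≤ a (q * n + r)) :
    ∃ H, Tendsto (fun N : ℕ => a N / N) atTop (nhds H) := by
  have hD0 : 0 ≤ D := by simpa using (abs_nonneg _).trans (hD 1 one_pos)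
  set v : ℕ → ℝ := fun n => (a (n + 1) - C * √((n + 1 : ℕ) : ℝ)) / ((n + 1 : ℕ) : ℝ) with hv
  have hbdd : BddAbove (Set.range v) := by
    refine ⟨D, ?_⟩
    rintro _ ⟨n, rfl⟩
    rw [hv, div_le_iff₀ (by positivity)]
    have := (abs_le.1 (hD (n + 1) n.succ_pos)).2
    have := mul_nonneg hC (Real.sqrt_nonneg ((n + 1 : ℕ) : ℝ))
    linarith
  refine ⟨⨆ n, v n, tendsto_order.2 ⟨fun y hy => ?_, fun y hy => ?_⟩⟩
  · obtain ⟨n, hn⟩ := exists_lt_of_lt_ciSup hy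
    set K := (|v n| + D + C) * (n + 1 : ℕ) with hK
    have hlim : Tendsto (fun N : ℕ => v n - K / N) atTop (nhds (v n)) := by
      simpa using tendsto_const_nhds.sub (tendsto_const_div_atTop_nhds_zero_nat K)
    filter_upwards [hlim.eventually_const_lt hn, eventually_gt_atTop 0] with N hN hN0
    refine hN.trans_le ?_
    have hN0' : (0 : ℝ) < N := by exact_mod_cast hN0
    have hdec : (N - 1) / (n + 1) * (n + 1) + ((N - 1) % (n + 1) + 1) = N := by
      have := Nat.div_add_mod' (N - 1) (n + 1)
      omega
    have hr := Nat.mod_lt (N - 1) n.succ_pos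
    have hk := h ((N - 1) / (n + 1)) (n + 1) ((N - 1) % (n + 1) + 1) n.succ_pos
      (Nat.succ_pos _)
    rw [hdec] at hk
    generalize (N - 1) / (n + 1) = q at *
    generalize (N - 1) % (n + 1) = r' at *
    have hvn : a (n + 1) - C * √((n + 1 : ℕ) : ℝ) = v n * (n + 1 : ℕ) := by
      rw [hv, div_mul_cancel₀ _ (by positivity)]
    rw [hvn] at hk
    have hr1 := (abs_le.1 (hD (r' + 1) r'.succ_pos)).1
    have hr2 : √((r' + 1 : ℕ) : ℝ) ≤ (r' + 1 : ℕ) := by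
      rw [Real.sqrt_le_left (by positivity)]
      have : (1 : ℝ) ≤ (r' + 1 : ℕ) := by simp
      nlinarith
    have hdec' : (q : ℝ) * (n + 1 : ℕ) = N - (r' + 1 : ℕ) := by
      rw [← hdec]
      push_cast
      ring
    have hrn : ((r' + 1 : ℕ) : ℝ) ≤ (n + 1 : ℕ) := by exact_mod_cast hr
    rw [le_div_iff₀ hN0', sub_mul, div_mul_cancel₀ _ hN0'.ne']
    have e1 : (q : ℝ) * (v n * (n + 1 : ℕ)) = v n * N - v n * (r' + 1 : ℕ) := by
      rw [mul_left_comm, hdec']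
      ring
    rw [e1] at hk
    have e2 : (|v n| + D + C) * (r' + 1 : ℕ) ≤ K :=
      mul_le_mul_of_nonneg_left hrn (by positivity)
    have e3 := mul_le_mul_of_nonneg_right (le_abs_self (v n))
      (Nat.cast_nonneg (α := ℝ) (r' + 1))
    have e4 := mul_le_mul_of_nonneg_left hr2 hC
    linarith
  · have hlim : Tendsto (fun N : ℕ => (⨆ n, v n) + C / √(N : ℝ)) atTop (nhds (⨆ n, v n)) := by
      have := (tendsto_const_nhds (x := C)).div_atTop
        (Real.tendsto_sqrt_atTop.comp (tendsto_natCast_atTop_atTop (R := ℝ)))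
      simpa using tendsto_const_nhds.add this
    filter_upwards [hlim.eventually_lt_const hy, eventually_gt_atTop 0] with N hN hN0
    refine lt_of_le_of_lt ?_ hN
    obtain ⟨n, rfl⟩ := Nat.exists_eq_succ_of_ne_zero hN0.ne'
    have := le_ciSup hbdd n
    have hs : C * √((n + 1 : ℕ) : ℝ) / ((n + 1 : ℕ) : ℝ) = C / √((n + 1 : ℕ) : ℝ) := by
      rw [mul_div_assoc, Real.sqrt_div_self, ← div_eq_mul_inv]
    have hvn : v n = a (n + 1) / ((n + 1 : ℕ) : ℝ) - C / √((n + 1 : ℕ) : ℝ) := by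
      rw [← hs, ← sub_div]
    rw [hvn] at this
    exact sub_le_iff_le_add.1 this

theorem isingMax_eq_top (β B : ℝ) {N M : ℕ} (E : Fin M → Fin N × Fin N) :
    isingMax β B E =
      top (fieldEnergy B (Fin N) + ∑ m, edgeEnergy β (E m).1 (E m).2) := by
  simp [isingMax, top, fieldEnergy, edgeEnergy]

theorem avg_isingMax_sub_sq_le {β : ℝ} (hβ : 0 < β) (B : ℝ) {N : ℕ} (hN : 0 < N) (M : ℕ) :
    (∑ E : Fin M → Fin N × Fin N, (isingMax β B E - meanTop β B (Fin N) M) ^ 2) /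
      Fintype.card (Fin M → Fin N × Fin N) ≤ M * β ^ 2 := by
  have : Nonempty (Fin N) := ⟨⟨0, hN⟩⟩
  have hcard : (Fintype.card (Fin M → Fin N × Fin N) : ℝ) = ((N : ℝ) ^ 2) ^ M := by
    simp [sq]
  have hpos : (0 : ℝ) < ((N : ℝ) ^ 2) ^ M := by positivity
  have h := lip_top.avgEdge_pow_sq_le hβ (id : Fin N → Fin N) M (fieldEnergy B (Fin N))
  have hmean : meanTop β B (Fin N) M = (((N : ℝ) ^ 2) ^ M)⁻¹ *
      ∑ E : Fin M → Fin N × Fin N, isingMax β B E := by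
    rw [meanTop, avgEdge_pow_apply, Fintype.card_fin]
    simp_rw [isingMax_eq_top]
  change _ ≤ (meanTop β B (Fin N) M) ^ 2 + _ at h
  rw [avgEdge_pow_apply, Fintype.card_fin] at h
  simp only [Pi.pow_apply, ← isingMax_eq_top] at h
  simp only [sub_sq, Finset.sum_add_distrib, Finset.sum_sub_distrib, Finset.sum_const,
    Finset.card_univ, nsmul_eq_mul, ← Finset.sum_mul, ← Finset.mul_sum]
  rw [hcard]
  have hsum : ∑ E : Fin M → Fin N × Fin N, isingMax β B E =
      ((N : ℝ) ^ 2) ^ M * meanTop β B (Fin N) M := by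
    rw [hmean, mul_inv_cancel_left₀ hpos.ne']
  rw [hsum, div_le_iff₀ hpos]
  rw [inv_mul_le_iff₀ hpos] at h
  nlinarith

theorem probER_le_avg {N M : ℕ} {p : (Fin M → Fin N × Fin N) → Prop}
    {f : (Fin M → Fin N × Fin N) → ℝ} (hf : ∀ E, 0 ≤ f E) {t : ℝ} (ht : 0 < t)
    (hp : ∀ E, p E → t ≤ f E) :
    probER N M p ≤ (∑ E, f E) / Fintype.card (Fin M → Fin N × Fin N) / t := by
  unfold probER
  rw [div_right_comm]
  refine div_le_div_of_nonneg_right ?_ (by positivity)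
  rw [le_div_iff₀ ht, ← nsmul_eq_mul]
  refine (Finset.card_nsmul_le_sum _ f t fun E hE => hp E (Finset.mem_filter.1 hE).2).trans ?_
  exact Finset.sum_le_sum_of_subset_of_nonneg (Finset.filter_subset _ _) fun E _ _ => hf E

end Ising

/-- For the Erdős–Rényi multigraph `G(N, ⌊cN⌋)`, the antiferromagnetic Ising ground state
value normalized by `N` converges with high probability to a constant `H(c)`. -/
theorem ising_scaling_limit_ER (c β B : ℝ) (hc : 0 < c) (hβ : 0 < β) :
    ∃ H : ℝ,
      ∀ ε : ℝ, 0 < ε →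
        Tendsto (fun N : ℕ =>
            probER N ⌊c * (N : ℝ)⌋₊
              (fun E => ε < |isingMax β B E / (N : ℝ) - H|))
          atTop (nhds 0) := by
  obtain ⟨H, hH⟩ := Ising.exists_tendsto_div_of_mul_add_ge (a := Ising.meanER c β B)
    (by positivity) (fun n hn => Ising.abs_meanER_le hc hβ B hn)
    (fun q n r hn hr => Ising.meanER_mul_add_ge hc hβ B q hn hr)
  refine ⟨H, fun ε hε => ?_⟩
  refine squeeze_zero' (.of_forall fun N => by unfold probER; positivity) ?_
    (tendsto_const_div_atTop_nhds_zero_nat (c * β ^ 2 / (ε / 2) ^ 2))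
  filter_upwards [Metric.tendsto_nhds.1 hH (ε / 2) (by positivity), eventually_gt_atTop 0]
    with N hN hN0
  have hN' : (0 : ℝ) < N := by exact_mod_cast hN0
  rw [Real.dist_eq] at hN
  calc _ ≤ _ := Ising.probER_le_avg
        (f := fun E => (isingMax β B E - Ising.meanER c β B N) ^ 2) (t := (ε / 2 * N) ^ 2)
        (fun E => sq_nonneg _) (by positivity) fun E hE => ?_
    _ ≤ ⌊c * (N : ℝ)⌋₊ * β ^ 2 / (ε / 2 * N) ^ 2 :=
        div_le_div_of_nonneg_right (Ising.avg_isingMax_sub_sq_le hβ B hN0 _) (by positivity)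
    _ ≤ c * N * β ^ 2 / (ε / 2 * N) ^ 2 := by
        gcongr
        exact Nat.floor_le (by positivity)
    _ = _ := by field_simp
  have h1 : ε / 2 ≤ |isingMax β B E / N - Ising.meanER c β B N / N| := by
    have := abs_sub_le (isingMax β B E / N) (Ising.meanER c β B N / N) H
    linarith
  rw [← sub_div, abs_div, abs_of_pos hN', le_div_iff₀ hN'] at h1
  rw [← sq_abs (isingMax β B E - _)]
  gcongr
end

section
/- Fix a real constant c > 0 and an integer q ≥ 2. For each N let G(N, ⌊cN⌋) be the Erdős–Rényi directed multigraph on [N] with ⌊cN⌋ edges, and let H_N denote the maximum, over all maps x : [N] → {0,…,q−1}, of the number of edge indices m with x(i_m) ≠ x(j_m), where e_m = (i_m, j_m). Then there exists a constant H(c) such that H_N / N converges to H(c) with high probability as N → ∞. -/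
open Filter
open scoped Classical

/-- The partial `q`-coloring value of the edge list `E`: the maximum over colorings
`x : Fin N → Fin q` of the number of edge indices whose endpoints receive
different colors. -/
noncomputable def maxColoring (q : ℕ) {N M : ℕ} (E : Fin M → Fin N × Fin N) : ℕ :=
  Finset.sup (Finset.univ : Finset (Fin N → Fin q)) (fun x =>
    ((Finset.univ : Finset (Fin M)).filter (fun m => x (E m).1 ≠ x (E m).2)).card)

section Step

variable {A A' ι κ : Type*} [AddCommMonoid A] [AddCommMonoid A'] [Fintype ι] [Fintype κ]

/-- The averaging operator of the random walk on `A` whose increment is `d i` with weight `p i`. -/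
noncomputable def walkStep (p : ι → ℝ) (d : ι → A) : Module.End ℝ (A → ℝ) where
  toFun F a := ∑ i, p i * F (a + d i)
  map_add' F G := by
    ext a
    simp [mul_add, Finset.sum_add_distrib]
  map_smul' c F := by
    ext a
    simp only [Pi.smul_apply, smul_eq_mul, RingHom.id_apply, Finset.mul_sum]
    exact Finset.sum_congr rfl fun i _ => by ring

lemma walkStep_apply (p : ι → ℝ) (d : ι → A) (F : A → ℝ) (a : A) :
    walkStep p d F a = ∑ i, p i * F (a + d i) := rfl

lemma walkStep_comm (p : ι → ℝ) (d : ι → A) (p' : κ → ℝ) (d' : κ → A) :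
    Commute (walkStep p d) (walkStep p' d') := by
  refine LinearMap.ext fun F => funext fun a => ?_
  simp only [Module.End.mul_apply, walkStep_apply, Finset.mul_sum]
  rw [Finset.sum_comm]
  refine Finset.sum_congr rfl fun i _ => Finset.sum_congr rfl fun j _ => ?_
  rw [add_right_comm]
  ring

lemma walkStep_mono {p : ι → ℝ} (hp : ∀ i, 0 ≤ p i) (d : ι → A) : Monotone (walkStep p d) :=
  fun _ _ h _ => Finset.sum_le_sum fun i _ => mul_le_mul_of_nonneg_left (h _) (hp i)

lemma monotone_end_pow {X : Type*} {T : Module.End ℝ (X → ℝ)} (hT : Monotone T) (M : ℕ) :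
    Monotone (T ^ M) := by
  intro F G h
  rw [Module.End.pow_apply, Module.End.pow_apply]
  exact hT.iterate M h

lemma walkStep_const {p : ι → ℝ} (hp : ∑ i, p i = 1) (d : ι → A) (c : ℝ) :
    walkStep p d (fun _ => c) = fun _ => c := by
  ext a
  rw [walkStep_apply, ← Finset.sum_mul, hp, one_mul]

lemma walkStep_pow_const {p : ι → ℝ} (hp : ∑ i, p i = 1) (d : ι → A) (c : ℝ) (M : ℕ) :
    (walkStep p d ^ M) (fun _ => c) = fun _ => c := by
  induction M with
  | zero => rfl
  | succ M ih => rw [pow_succ, Module.End.mul_apply, walkStep_const hp, ih]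

lemma walkStep_pow_map (p : ι → ℝ) (d : ι → A) (π : A →+ A') (F : A' → ℝ) (M : ℕ) (a : A) :
    (walkStep p (fun i => π (d i)) ^ M) F (π a) = (walkStep p d ^ M) (fun b => F (π b)) a := by
  induction M generalizing a with
  | zero => rfl
  | succ M ih =>
    rw [pow_succ', pow_succ', Module.End.mul_apply, Module.End.mul_apply, walkStep_apply,
      walkStep_apply]
    refine Finset.sum_congr rfl fun i _ => ?_
    rw [← map_add, ih]

lemma walkStep_pow_eq_sum (w : ℝ) (d : ι → A) (F : A → ℝ) (M : ℕ) (a : A) :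
    (walkStep (fun _ => w) d ^ M) F a = w ^ M * ∑ E : Fin M → ι, F (a + ∑ m, d (E m)) := by
  induction M generalizing a with
  | zero => simp
  | succ M ih =>
    rw [pow_succ', Module.End.mul_apply, walkStep_apply,
      ← (Fin.consEquiv fun _ => ι).sum_comp, Fintype.sum_prod_type, Finset.mul_sum]
    refine Finset.sum_congr rfl fun i _ => ?_
    rw [ih]
    simp only [Fin.consEquiv_apply, Fin.sum_univ_succ, Fin.cons_zero, Fin.cons_succ, add_assoc]
    ring

/-- Comparison of commuting monotone operators can be iterated. -/
lemma end_pow_le_pow {X : Type*} {S T : Module.End ℝ (X → ℝ)} (hS : Monotone S) (hT : Monotone T)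
    (hST : Commute S T) {F : X → ℝ} (h : S F ≤ T F) (M : ℕ) : (S ^ M) F ≤ (T ^ M) F := by
  induction M with
  | zero => exact le_rfl
  | succ M ih =>
    calc (S ^ (M + 1)) F = S ((S ^ M) F) := by rw [pow_succ', Module.End.mul_apply]
      _ ≤ S ((T ^ M) F) := hS ih
      _ = (T ^ M) (S F) := by
        rw [← Module.End.mul_apply, ← Module.End.mul_apply, (hST.pow_right M).eq]
      _ ≤ (T ^ M) (T F) := monotone_end_pow hT M h
      _ = (T ^ (M + 1)) F := by rw [pow_succ, Module.End.mul_apply]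

lemma walkStep_pow_increment {p : ι → ℝ} (hp : ∀ i, 0 ≤ p i) (hp1 : ∑ i, p i = 1)
    {d : ι → A} {F : A → ℝ} (h0 : ∀ a i, F a ≤ F (a + d i)) (h1 : ∀ a i, F (a + d i) ≤ F a + 1)
    (M : ℕ) (a : A) (i : ι) :
    (walkStep p d ^ M) F a ≤ (walkStep p d ^ M) F (a + d i) ∧
      (walkStep p d ^ M) F (a + d i) ≤ (walkStep p d ^ M) F a + 1 := by
  induction M generalizing a with
  | zero => exact ⟨h0 a i, h1 a i⟩
  | succ M ih =>
    simp only [pow_succ', Module.End.mul_apply, walkStep_apply]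
    constructor
    · refine Finset.sum_le_sum fun j _ => mul_le_mul_of_nonneg_left ?_ (hp j)
      rw [add_right_comm]
      exact (ih _).1
    · rw [← hp1, ← Finset.sum_add_distrib]
      refine Finset.sum_le_sum fun j _ => ?_
      rw [← mul_add_one, add_right_comm]
      exact mul_le_mul_of_nonneg_left (ih _).2 (hp j)

lemma walkStep_pow_succ_bounds {p : ι → ℝ} (hp : ∀ i, 0 ≤ p i) (hp1 : ∑ i, p i = 1)
    {d : ι → A} {F : A → ℝ} (h0 : ∀ a i, F a ≤ F (a + d i)) (h1 : ∀ a i, F (a + d i) ≤ F a + 1)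
    (M : ℕ) (a : A) :
    (walkStep p d ^ M) F a ≤ (walkStep p d ^ (M + 1)) F a ∧
      (walkStep p d ^ (M + 1)) F a ≤ (walkStep p d ^ M) F a + 1 := by
  have h := fun i => walkStep_pow_increment hp hp1 h0 h1 M a i
  rw [pow_succ', Module.End.mul_apply, walkStep_apply]
  constructor
  · calc (walkStep p d ^ M) F a = ∑ i, p i * (walkStep p d ^ M) F a := by
          rw [← Finset.sum_mul, hp1, one_mul]
      _ ≤ _ := Finset.sum_le_sum fun i _ => mul_le_mul_of_nonneg_left (h i).1 (hp i)
  · calc _ ≤ ∑ i, p i * ((walkStep p d ^ M) F a + 1) :=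
          Finset.sum_le_sum fun i _ => mul_le_mul_of_nonneg_left (h i).2 (hp i)
      _ = _ := by rw [← Finset.sum_mul, hp1, one_mul]

/-- Each step of the walk contributes at most one to the variance. -/
lemma walkStep_pow_sq_le {p : ι → ℝ} (hp : ∀ i, 0 ≤ p i) (hp1 : ∑ i, p i = 1)
    {d : ι → A} {F : A → ℝ} (h0 : ∀ a i, F a ≤ F (a + d i)) (h1 : ∀ a i, F (a + d i) ≤ F a + 1)
    (M : ℕ) (a : A) :
    (walkStep p d ^ M) (fun b => F b ^ 2) a ≤ (walkStep p d ^ M) F a ^ 2 + M := by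
  induction M generalizing a with
  | zero => simp
  | succ M ih =>
    set U := (walkStep p d ^ M) F with hU
    have hinc := fun i => walkStep_pow_increment hp hp1 h0 h1 M a i
    rw [← hU] at hinc
    rw [pow_succ', Module.End.mul_apply, Module.End.mul_apply, ← hU, walkStep_apply,
      walkStep_apply]
    set u := U a
    have e1 : ∑ i, p i * (walkStep p d ^ M) (fun b => F b ^ 2) (a + d i) ≤
        ∑ i, p i * (U (a + d i) ^ 2 + M) :=
      Finset.sum_le_sum fun i _ => mul_le_mul_of_nonneg_left (ih _) (hp i)
    have e2 : ∑ i, p i * (U (a + d i) ^ 2 + M) ≤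
        ∑ i, (2 * u * (p i * U (a + d i)) + p i * (M + 1 - u ^ 2)) := by
      refine Finset.sum_le_sum fun i _ => ?_
      have h3 : (U (a + d i) - u) ^ 2 ≤ 1 := by
        have := hinc i
        rw [sq_le_one_iff_abs_le_one, abs_le]
        constructor <;> linarith
      nlinarith [mul_le_mul_of_nonneg_left h3 (hp i)]
    rw [Finset.sum_add_distrib, ← Finset.mul_sum, ← Finset.sum_mul, hp1] at e2
    push_cast
    nlinarith [sq_nonneg (∑ i, p i * U (a + d i) - u)]

lemma walkStep_pow_sub_sq_le {p : ι → ℝ} (hp : ∀ i, 0 ≤ p i) (hp1 : ∑ i, p i = 1)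
    {d : ι → A} {F : A → ℝ} (h0 : ∀ a i, F a ≤ F (a + d i)) (h1 : ∀ a i, F (a + d i) ≤ F a + 1)
    (M : ℕ) (a : A) :
    (walkStep p d ^ M) (fun b => (F b - (walkStep p d ^ M) F a) ^ 2) a ≤ M := by
  set u := (walkStep p d ^ M) F a with hu
  have h : (fun b => (F b - u) ^ 2) = (fun b => F b ^ 2) - (2 * u) • F + fun _ => u ^ 2 := by
    ext b
    simp only [Pi.add_apply, Pi.sub_apply, Pi.smul_apply, smul_eq_mul]
    ring
  rw [h, map_add, map_sub, map_smul, walkStep_pow_const hp1]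
  simp only [Pi.add_apply, Pi.sub_apply, Pi.smul_apply, smul_eq_mul, ← hu]
  have := walkStep_pow_sq_le hp hp1 h0 h1 M a
  rw [← hu] at this
  linarith

/-- Quadratic lower bound for a lazy iterate of a monotone operator. -/
lemma lazy_pow_lower_bound {X : Type*} {T : Module.End ℝ (X → ℝ)} {F : X → ℝ} {a : X} {ρ α β γ : ℝ}
    (hρ0 : 0 ≤ ρ) (hρ1 : ρ ≤ 1) (h : ∀ j : ℕ, α - β * ((j : ℝ) - γ) ^ 2 ≤ (T ^ j) F a)
    (M j : ℕ) :
    α - β * (((j : ℝ) + M * ρ - γ) ^ 2 + M * ρ * (1 - ρ)) ≤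
      (((1 - ρ) • (1 : Module.End ℝ (X → ℝ)) + ρ • T) ^ M) ((T ^ j) F) a := by
  induction M generalizing j with
  | zero => simpa using h j
  | succ M ih =>
    have e : ((1 - ρ) • (1 : Module.End ℝ (X → ℝ)) + ρ • T) ((T ^ j) F) =
        (1 - ρ) • (T ^ j) F + ρ • (T ^ (j + 1)) F := by
      rw [pow_succ' T j]
      rfl
    rw [pow_succ _ M, Module.End.mul_apply, e, map_add, map_smul, map_smul]
    simp only [Pi.add_apply, Pi.smul_apply, smul_eq_mul]
    have h1 := mul_le_mul_of_nonneg_left (ih j) (sub_nonneg.2 hρ1)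
    have h2 := mul_le_mul_of_nonneg_left (ih (j + 1)) hρ0
    refine le_trans (le_of_eq ?_) (add_le_add h1 h2)
    push_cast
    ring

end Step

section Coloring

variable {q : ℕ} {V : Type*} [Fintype V]

/-- The increment of the score of a coloring when the edge `e` is added. -/
def edgeScore (q : ℕ) {V : Type*} (e : V × V) : (V → Fin q) → ℕ :=
  fun x => if x e.1 = x e.2 then 0 else 1

/-- The best score of a coloring. -/
noncomputable def bestScore (g : (V → Fin q) → ℕ) : ℕ := Finset.univ.sup g

lemma le_bestScore (g : (V → Fin q) → ℕ) (x : V → Fin q) : g x ≤ bestScore g :=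
  Finset.le_sup (f := g) (Finset.mem_univ x)

lemma bestScore_le {g : (V → Fin q) → ℕ} {n : ℕ} (h : ∀ x, g x ≤ n) : bestScore g ≤ n :=
  Finset.sup_le fun x _ => h x

lemma exists_eq_bestScore [NeZero q] (g : (V → Fin q) → ℕ) : ∃ x, g x = bestScore g := by
  obtain ⟨x, -, hx⟩ := Finset.exists_mem_eq_sup Finset.univ Finset.univ_nonempty g
  exact ⟨x, hx.symm⟩

lemma maxColoring_eq_bestScore {N M : ℕ} (E : Fin M → Fin N × Fin N) :
    maxColoring q E = bestScore (∑ m, edgeScore q (E m)) := by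
  unfold maxColoring bestScore
  refine Finset.sup_congr (by ext; simp) fun x _ => ?_
  rw [Finset.sum_apply, Finset.card_filter]
  refine Finset.sum_congr rfl fun m _ => ?_
  simp [edgeScore]

/-- The colors given to `v` by the optimal colorings; two vertices have the same signature
iff no optimal coloring separates them. -/
noncomputable def optSignature (g : (V → Fin q) → ℕ) (v : V) :
    {x : V → Fin q // g x = bestScore g} → Fin q := fun x => x.1 v

lemma bestScore_add_edgeScore [NeZero q] (g : (V → Fin q) → ℕ) (e : V × V) :
    bestScore (g + edgeScore q e) =
      bestScore g + if optSignature g e.1 = optSignature g e.2 then 0 else 1 := by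
  split_ifs with h
  · apply le_antisymm
    · refine bestScore_le fun x => ?_
      have hx := le_bestScore g x
      simp only [Pi.add_apply, edgeScore]
      split_ifs with hxe
      · omega
      · have : g x ≠ bestScore g := fun hg => hxe (congrFun h ⟨x, hg⟩)
        omega
    · obtain ⟨x, hx⟩ := exists_eq_bestScore g
      refine le_trans ?_ (le_bestScore _ x)
      simp only [Pi.add_apply]
      omega
  · apply le_antisymm
    · refine bestScore_le fun x => ?_
      have hx := le_bestScore g x
      simp only [Pi.add_apply, edgeScore]
      split_ifs <;> omega
    · obtain ⟨⟨x, hx⟩, hxe⟩ := Function.ne_iff.1 h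
      refine le_trans ?_ (le_bestScore _ x)
      have hxe' : x e.1 ≠ x e.2 := hxe
      simp only [Pi.add_apply, edgeScore, if_neg hxe']
      omega

lemma bestScore_le_add_edgeScore [NeZero q] (g : (V → Fin q) → ℕ) (e : V × V) :
    (bestScore g : ℝ) ≤ bestScore (g + edgeScore q e) := by
  rw [bestScore_add_edgeScore]
  exact_mod_cast Nat.le_add_right _ _

lemma bestScore_add_edgeScore_le [NeZero q] (g : (V → Fin q) → ℕ) (e : V × V) :
    (bestScore (g + edgeScore q e) : ℝ) ≤ bestScore g + 1 := by
  rw [bestScore_add_edgeScore]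
  split_ifs <;> push_cast <;> linarith

/-- Averaging over one uniform edge on `V`. -/
noncomputable def uniformStep (q : ℕ) (V : Type*) [Fintype V] :
    Module.End ℝ (((V → Fin q) → ℕ) → ℝ) :=
  walkStep (fun _ => ((Fintype.card V : ℝ) ^ 2)⁻¹) (edgeScore q (V := V))

lemma uniform_weight_sum [Nonempty V] :
    ∑ _e : V × V, ((Fintype.card V : ℝ) ^ 2)⁻¹ = 1 := by
  have : (Fintype.card V : ℝ) ≠ 0 := by exact_mod_cast Fintype.card_ne_zero
  simp only [Finset.sum_const, Finset.card_univ, Fintype.card_prod, nsmul_eq_mul]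
  push_cast
  field_simp

/-- Merging blocks can only lower the probability that two random elements coincide under `f`;
here the blocks are `k` blocks of size `n` and `r` singletons. -/
lemma collision_le {C : Type*} [Fintype C] {k n r : ℕ} (hn : 0 < n)
    (hN : 0 < k * n + r) (f : (Fin k × Fin n) ⊕ Fin r → C) :
    ∑ i, ∑ j, (if f i = f j then (1 : ℝ) else 0) ≤
      ((k * n + r : ℕ) : ℝ) * (∑ b : Fin k, (n : ℝ)⁻¹ * ∑ i : Fin n, ∑ j : Fin n,
        (if f (.inl (b, i)) = f (.inl (b, j)) then (1 : ℝ) else 0) + r) := by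
  have hsq : ∀ {W : Type} [Fintype W] (g : W → C),
      ∑ i, ∑ j, (if g i = g j then (1 : ℝ) else 0) =
        ∑ z : C, (∑ i, if g i = z then (1 : ℝ) else 0) ^ 2 := by
    intro W _ g
    simp only [sq, Finset.sum_mul_sum]
    rw [Finset.sum_comm (s := (Finset.univ : Finset C))]
    refine Finset.sum_congr rfl fun i _ => ?_
    rw [Finset.sum_comm (s := (Finset.univ : Finset C))]
    refine Finset.sum_congr rfl fun j _ => ?_
    simp [eq_comm]
  have hr : (r : ℝ) = ∑ z : C, ∑ t : Fin r, (if f (.inr t) = z then (1 : ℝ) else 0) ^ 2 := by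
    rw [Finset.sum_comm]
    simp
  rw [hsq, hr]
  simp only [fun b : Fin k => hsq fun i : Fin n => f (.inl (b, i)), Finset.mul_sum]
  rw [Finset.sum_comm, ← Finset.sum_add_distrib, Finset.mul_sum]
  refine Finset.sum_le_sum fun z _ => ?_
  have hn' : (0 : ℝ) < n := by exact_mod_cast hn
  have key := Finset.sq_sum_div_le_sum_sq_div (Finset.univ : Finset (Fin k ⊕ Fin r))
    (Sum.elim (fun b => ∑ i : Fin n, if f (.inl (b, i)) = z then (1 : ℝ) else 0)
      (fun t => if f (.inr t) = z then (1 : ℝ) else 0))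
    (g := Sum.elim (fun _ => (n : ℝ)) (fun _ => 1)) (by rintro (b | t) - <;> simp [hn])
  simp only [Fintype.sum_sum_type, Sum.elim_inl, Sum.elim_inr, Finset.sum_const,
    Finset.card_univ, Fintype.card_fin, nsmul_eq_mul, mul_one, div_one] at key
  have hN' : (0 : ℝ) < (k : ℝ) * n + r := by exact_mod_cast hN
  rw [div_le_iff₀ hN'] at key
  simp only [Fintype.sum_sum_type, Fintype.sum_prod_type]
  push_cast
  refine key.trans (le_of_eq ?_)
  simp only [div_eq_inv_mul]
  ring

variable {k n r : ℕ}

/-- Scores on the blocks, added up to a score on the whole vertex set. -/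
def mergeScores (σ : (Fin k × Fin n) ⊕ Fin r ≃ V) :
    (Fin k → (Fin n → Fin q) → ℕ) →+ ((V → Fin q) → ℕ) where
  toFun G x := ∑ b, G b fun i => x (σ (.inl (b, i)))
  map_zero' := by
    ext x
    simp
  map_add' G G' := by
    ext x
    simp [Finset.sum_add_distrib]

lemma mergeScores_apply {W : Type*} (σ : (Fin k × Fin n) ⊕ Fin r ≃ W)
    (G : Fin k → (Fin n → Fin q) → ℕ) (x : W → Fin q) : mergeScores σ G x = ∑ b, G b fun i => x (σ (.inl (b, i))) := rfl

/-- Weights of a random edge which is uniform inside the block of a uniform vertex. -/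
noncomputable def blockWeight (k n r : ℕ) : (Fin k × Fin n × Fin n) ⊕ Fin r → ℝ :=
  Sum.elim (fun _ => ((k * n + r : ℕ) : ℝ)⁻¹ * (n : ℝ)⁻¹) (fun _ => ((k * n + r : ℕ) : ℝ)⁻¹)

/-- Blockwise score increments of an edge inside a block. -/
noncomputable def blockScore (q k n r : ℕ) :
    (Fin k × Fin n × Fin n) ⊕ Fin r → Fin k → (Fin n → Fin q) → ℕ :=
  Sum.elim (fun e => Pi.single e.1 (edgeScore q e.2)) (fun _ => 0)

lemma blockWeight_nonneg (i) : 0 ≤ blockWeight k n r i := by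
  rcases i with i | i <;> simp only [blockWeight, Sum.elim_inl, Sum.elim_inr] <;> positivity

lemma mergeScores_single {W : Type*} (σ : (Fin k × Fin n) ⊕ Fin r ≃ W) (b : Fin k)
    (e : Fin n × Fin n) :
    mergeScores σ (Pi.single b (edgeScore q e)) =
      edgeScore q (σ (.inl (b, e.1)), σ (.inl (b, e.2))) := by
  ext x
  rw [mergeScores_apply, Finset.sum_eq_single b]
  · simp [edgeScore]
  · intro b' _ hb
    simp [Pi.single_eq_of_ne hb]
  · simp

lemma blockStep_bestScore_le [NeZero q] (hn : 0 < n) (hN : 0 < k * n + r)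
    (σ : (Fin k × Fin n) ⊕ Fin r ≃ V) (g : (V → Fin q) → ℕ) :
    walkStep (blockWeight k n r) (fun i => mergeScores σ (blockScore q k n r i))
        (fun g => (bestScore g : ℝ)) g ≤
      uniformStep q V (fun g => (bestScore g : ℝ)) g := by
  have hcard : Fintype.card V = k * n + r := by
    rw [← Fintype.card_congr σ]
    simp
  have hn' : (n : ℝ) ≠ 0 := by exact_mod_cast hn.ne'
  have hN' : (0 : ℝ) < ((k * n + r : ℕ) : ℝ) := by exact_mod_cast hN
  have hNe := Nat.cast_add (R := ℝ) (k * n) r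
  rw [Nat.cast_mul] at hNe
  have hb : ∀ e : V × V, (bestScore (g + edgeScore q e) : ℝ) = (bestScore g + 1) -
      if optSignature g e.1 = optSignature g e.2 then 1 else 0 := by
    intro e
    rw [bestScore_add_edgeScore]
    split_ifs <;> push_cast <;> ring
  have key := collision_le hn hN fun v => optSignature g (σ v)
  rw [uniformStep, walkStep_apply, walkStep_apply, hcard]
  simp only [Fintype.sum_sum_type, Fintype.sum_prod_type, blockWeight, blockScore, Sum.elim_inl,
    Sum.elim_inr, mergeScores_single, map_zero, add_zero, hb]
  set N : ℝ := ((k * n + r : ℕ) : ℝ)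
  set h : ℝ := (bestScore g : ℝ)
  rw [← σ.sum_comp]
  simp only [fun i : V => (σ.sum_comp fun j => (N ^ 2)⁻¹ * (h + 1 -
    if optSignature g i = optSignature g j then 1 else 0)).symm]
  simp only [← Finset.mul_sum, Finset.sum_sub_distrib, Finset.sum_const, Finset.card_univ,
    Fintype.card_fin, Fintype.card_sum, Fintype.card_prod, nsmul_eq_mul] at key ⊢
  set Q := ∑ i, ∑ j, (if optSignature g (σ i) = optSignature g (σ j) then (1 : ℝ) else 0)
  set R := ∑ b : Fin k, ∑ i : Fin n, ∑ j : Fin n,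
    (if optSignature g (σ (.inl (b, i))) = optSignature g (σ (.inl (b, j))) then (1 : ℝ) else 0)
  change _ ≤ (N ^ 2)⁻¹ * (N * (N * (h + 1)) - Q)
  have e1 : (N ^ 2)⁻¹ * (N * (N * (h + 1)) - Q) = h + 1 - Q / N ^ 2 := by
    field_simp
  have e2 : N⁻¹ * (n : ℝ)⁻¹ * (n * (n * (k * (h + 1))) - R) + N⁻¹ * (r * h) =
      h + 1 - ((n : ℝ)⁻¹ * R + r) / N := by
    field_simp
    rw [hNe]
    ring
  rw [e1, e2]
  have key' : Q ≤ N * ((n : ℝ)⁻¹ * R + r) := by convert key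
  have : Q / N ^ 2 ≤ ((n : ℝ)⁻¹ * R + r) / N := by
    rw [div_le_div_iff₀ (by positivity) hN']
    nlinarith [mul_le_mul_of_nonneg_right key' hN'.le]
  linarith

lemma sum_bestScore_le_mergeScores [NeZero q] (σ : (Fin k × Fin n) ⊕ Fin r ≃ V)
    (G : Fin k → (Fin n → Fin q) → ℕ) :
    ∑ b, bestScore (G b) ≤ bestScore (mergeScores σ G) := by
  choose x hx using fun b => exists_eq_bestScore (G b)
  refine le_trans (le_of_eq ?_) (le_bestScore _
    (fun v => Sum.elim (fun w : Fin k × Fin n => x w.1 w.2) (fun _ => 0) (σ.symm v)))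
  rw [mergeScores_apply]
  refine Finset.sum_congr rfl fun b _ => ?_
  simp [hx]

lemma blockStep_eq_lazy (hn : 0 < n) (hN : 0 < k * n + r) (b : Fin k) :
    walkStep (blockWeight k n r) (fun i => blockScore q k n r i b) =
      (1 - (n : ℝ) / (k * n + r : ℕ)) • (1 : Module.End ℝ (((Fin n → Fin q) → ℕ) → ℝ)) +
        ((n : ℝ) / (k * n + r : ℕ)) • uniformStep q (Fin n) := by
  refine LinearMap.ext fun F => funext fun g => ?_
  have hn' : (n : ℝ) ≠ 0 := by exact_mod_cast hn.ne'
  have hN' : ((k * n + r : ℕ) : ℝ) ≠ 0 := by exact_mod_cast hN.ne'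
  have hNe := Nat.cast_add (R := ℝ) (k * n) r
  rw [Nat.cast_mul] at hNe
  have hu : uniformStep q (Fin n) F g =
      ((n : ℝ) ^ 2)⁻¹ * ∑ e, F (g + edgeScore q e) := by
    rw [uniformStep, walkStep_apply, ← Finset.mul_sum, Fintype.card_fin]
  simp only [LinearMap.add_apply, LinearMap.smul_apply, Pi.add_apply, Pi.smul_apply,
    Module.End.one_apply, smul_eq_mul, hu]
  rw [walkStep_apply]
  rw [Fintype.sum_sum_type, Fintype.sum_prod_type]
  simp only [blockWeight, blockScore, Sum.elim_inl, Sum.elim_inr, ← Finset.mul_sum]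
  rw [← Finset.add_sum_erase _ _ (Finset.mem_univ b)]
  have e : ∀ b' ∈ Finset.univ.erase b, ∑ e : Fin n × Fin n,
      F (g + (Pi.single b' (edgeScore q e) : Fin k → (Fin n → Fin q) → ℕ) b) =
        (n : ℝ) ^ 2 * F g := by
    intro b' hb'
    simp only [Pi.single_eq_of_ne (Finset.ne_of_mem_erase hb').symm, add_zero]
    simp [sq]
  rw [Finset.sum_congr rfl e]
  have hk : 1 ≤ k := b.pos
  simp only [Pi.single_eq_same, Finset.sum_const, Finset.card_erase_of_mem (Finset.mem_univ b),
    Finset.card_univ, Fintype.card_fin, nsmul_eq_mul, Pi.zero_apply, add_zero,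
    Nat.cast_sub hk, Nat.cast_one]
  set Z := ∑ e, F (g + edgeScore q e)
  set N : ℝ := ((k * n + r : ℕ) : ℝ)
  field_simp
  rw [hNe]
  ring

/-- Expected maximal score of `M` uniform edges on `Fin N`. -/
noncomputable def expBestScore (q N M : ℕ) : ℝ :=
  (uniformStep q (Fin N) ^ M) (fun g => (bestScore g : ℝ)) 0

lemma expBestScore_succ_bounds [NeZero q] (hn : 0 < n) (M : ℕ) :
    expBestScore q n M ≤ expBestScore q n (M + 1) ∧
      expBestScore q n (M + 1) ≤ expBestScore q n M + 1 := by
  have : Nonempty (Fin n) := ⟨⟨0, hn⟩⟩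
  exact walkStep_pow_succ_bounds (fun _ => by positivity) uniform_weight_sum
    bestScore_le_add_edgeScore bestScore_add_edgeScore_le M 0

lemma expBestScore_sub_le_abs [NeZero q] (hn : 0 < n) (j m : ℕ) :
    expBestScore q n m - |(j : ℝ) - m| ≤ expBestScore q n j := by
  rcases le_total m j with h | h
  · have : Monotone (expBestScore q n) :=
      monotone_nat_of_le_succ fun M => (expBestScore_succ_bounds hn M).1
    linarith [this h, abs_nonneg ((j : ℝ) - m)]
  · have : Antitone fun M : ℕ => expBestScore q n M - M :=
      antitone_nat_of_succ_le fun M => by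
        have := (expBestScore_succ_bounds (q := q) hn M).2
        push_cast
        linarith
    have h2 := this h
    have h3 := neg_le_abs ((j : ℝ) - m)
    simp only at h2
    linarith

lemma expBestScore_zero [NeZero q] : expBestScore q n 0 = 0 := by
  have : bestScore (0 : (Fin n → Fin q) → ℕ) = 0 :=
    Nat.le_zero.1 (bestScore_le fun _ => le_rfl)
  simp [expBestScore, this]

lemma expBestScore_nonneg [NeZero q] (hn : 0 < n) (m : ℕ) : 0 ≤ expBestScore q n m := by
  have : Monotone (expBestScore q n) :=
    monotone_nat_of_le_succ fun M => (expBestScore_succ_bounds hn M).1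
  simpa [expBestScore_zero] using this (Nat.zero_le m)

lemma expBestScore_le [NeZero q] (hn : 0 < n) (m : ℕ) : expBestScore q n m ≤ m := by
  have := expBestScore_sub_le_abs (q := q) hn 0 m
  rw [expBestScore_zero] at this
  simp at this
  linarith

/-- Superadditivity over blocks, before estimating the fluctuation of the number of edges in
a block. -/
lemma sum_lazy_le_expBestScore [NeZero q] (hn : 0 < n) (hN : 0 < k * n + r) (M : ℕ) :
    k * (((1 - (n : ℝ) / (k * n + r : ℕ)) • (1 : Module.End ℝ (((Fin n → Fin q) → ℕ) → ℝ)) +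
        ((n : ℝ) / (k * n + r : ℕ)) • uniformStep q (Fin n)) ^ M)
          (fun g => (bestScore g : ℝ)) 0 ≤ expBestScore q (k * n + r) M := by
  have σ : (Fin k × Fin n) ⊕ Fin r ≃ Fin (k * n + r) := Fintype.equivOfCardEq (by simp)
  have h1 := end_pow_le_pow
    (walkStep_mono blockWeight_nonneg fun i => mergeScores σ (blockScore q k n r i))
    (walkStep_mono (fun _ => by positivity) _)
    (walkStep_comm _ _ _ _) (blockStep_bestScore_le (q := q) hn hN σ) M 0
  refine le_trans ?_ h1
  have h2 := walkStep_pow_map (blockWeight k n r) (blockScore q k n r) (mergeScores σ)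
    (fun g => (bestScore g : ℝ)) M 0
  rw [map_zero] at h2
  rw [h2]
  have h3 := monotone_end_pow (walkStep_mono blockWeight_nonneg (blockScore q k n r)) M
    (show (∑ b : Fin k, fun G : Fin k → (Fin n → Fin q) → ℕ => (bestScore (G b) : ℝ)) ≤
      fun G => (bestScore (mergeScores σ G) : ℝ) from fun G => by
        rw [Finset.sum_apply]
        beta_reduce
        exact_mod_cast sum_bestScore_le_mergeScores σ G) 0
  refine le_trans (le_of_eq ?_) h3
  rw [map_sum, Finset.sum_apply]
  have h4 : ∀ b : Fin k, (walkStep (blockWeight k n r) (blockScore q k n r) ^ M)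
      (fun G : Fin k → (Fin n → Fin q) → ℕ => (bestScore (G b) : ℝ)) 0 =
      (((1 - (n : ℝ) / (k * n + r : ℕ)) • (1 : Module.End ℝ (((Fin n → Fin q) → ℕ) → ℝ)) +
        ((n : ℝ) / (k * n + r : ℕ)) • uniformStep q (Fin n)) ^ M)
          (fun g => (bestScore g : ℝ)) 0 := by
    intro b
    rw [← blockStep_eq_lazy hn hN b]
    exact (walkStep_pow_map (blockWeight k n r) (blockScore q k n r)
      (Pi.evalAddMonoidHom (fun _ : Fin k => (Fin n → Fin q) → ℕ) b)
      (fun g => (bestScore g : ℝ)) M 0).symm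
  rw [Finset.sum_congr rfl fun b _ => h4 b]
  simp

lemma expBestScore_blocks [NeZero q] {c : ℝ} (hc : 0 < c) (hn : 0 < n) (hk : 0 < k) :
    k * (expBestScore q n ⌊c * n⌋₊ - √(c * n + 1)) ≤
      expBestScore q (k * n + r) ⌊c * ((k * n + r : ℕ) : ℝ)⌋₊ := by
  have hN : 0 < k * n + r := by positivity
  have hnN : n ≤ k * n + r := le_trans (Nat.le_mul_of_pos_left n hk) (Nat.le_add_right _ _)
  refine le_trans ?_ (sum_lazy_le_expBestScore hn hN _)
  refine mul_le_mul_of_nonneg_left ?_ (Nat.cast_nonneg k)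
  have hN' : (0 : ℝ) < ((k * n + r : ℕ) : ℝ) := by exact_mod_cast hN
  have hnN' : (n : ℝ) ≤ ((k * n + r : ℕ) : ℝ) := by exact_mod_cast hnN
  have hn' : (0 : ℝ) < n := by exact_mod_cast hn
  set N : ℝ := ((k * n + r : ℕ) : ℝ)
  set s := √(c * n + 1)
  have hs2 : s ^ 2 = c * n + 1 := Real.sq_sqrt (by positivity)
  have hs : 0 < s := Real.sqrt_pos.2 (by positivity)
  set m := ⌊c * n⌋₊
  set M := ⌊c * N⌋₊
  have hρ0 : 0 ≤ (n : ℝ) / N := by positivity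
  have hρ1 : (n : ℝ) / N ≤ 1 := (div_le_one hN').2 hnN'
  have key := lazy_pow_lower_bound (T := uniformStep q (Fin n))
    (F := fun g => (bestScore g : ℝ)) (a := 0) (α := expBestScore q n m - s / 2)
    (β := 1 / (2 * s)) (γ := m) hρ0 hρ1 (by
      intro j
      refine le_trans ?_ (expBestScore_sub_le_abs hn j m)
      have h : |(j : ℝ) - m| ≤ s / 2 + 1 / (2 * s) * ((j : ℝ) - m) ^ 2 := by
        rw [← sq_abs ((j : ℝ) - m)]
        have : s / 2 + 1 / (2 * s) * |(j : ℝ) - m| ^ 2 - |(j : ℝ) - m| =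
            (s - |(j : ℝ) - m|) ^ 2 / (2 * s) := by
          field_simp
          ring
        have h2 : 0 ≤ (s - |(j : ℝ) - m|) ^ 2 / (2 * s) := by positivity
        linarith
      linarith) M 0
  refine le_trans ?_ key
  have hm1 : (m : ℝ) ≤ c * n := Nat.floor_le (by positivity)
  have hm2 : c * n < m + 1 := Nat.lt_floor_add_one _
  have hM1 : (M : ℝ) ≤ c * N := Nat.floor_le (by positivity)
  have hM2 : c * N < M + 1 := Nat.lt_floor_add_one _
  have hc1 : c * N * (n / N) = c * n := by
    field_simp
  have hb1 : M * ((n : ℝ) / N) ≤ c * n := by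
    rw [← hc1]
    exact mul_le_mul_of_nonneg_right hM1 hρ0
  have hb2 : c * n ≤ M * ((n : ℝ) / N) + 1 := by
    rw [← hc1]
    nlinarith [mul_le_mul_of_nonneg_right hM2.le hρ0]
  have hb3 : (((0 : ℕ) : ℝ) + M * ((n : ℝ) / N) - m) ^ 2 ≤ 1 := by
    rw [sq_le_one_iff_abs_le_one, abs_le]
    push_cast
    constructor <;> linarith
  have hb4 : M * ((n : ℝ) / N) * (1 - (n : ℝ) / N) ≤ c * n := by
    refine le_trans ?_ hb1
    exact mul_le_of_le_one_right (by positivity) (by linarith)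
  have hb5 : 1 / (2 * s) * ((((0 : ℕ) : ℝ) + M * ((n : ℝ) / N) - m) ^ 2 +
      M * ((n : ℝ) / N) * (1 - (n : ℝ) / N)) ≤ 1 / (2 * s) * s ^ 2 :=
    mul_le_mul_of_nonneg_left (by linarith) (by positivity)
  have hb6 : 1 / (2 * s) * s ^ 2 = s / 2 := by
    field_simp
  linarith

lemma tendsto_natDiv_div_self (hn : 0 < n) :
    Tendsto (fun N : ℕ => ((N / n : ℕ) : ℝ) / N) atTop (nhds (1 / n)) := by
  have hn' : (0 : ℝ) < n := by exact_mod_cast hn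
  have h := (tendsto_nat_floor_mul_div_atTop (R := ℝ) (a := 1 / n) (by positivity)).comp
    tendsto_natCast_atTop_atTop
  refine h.congr fun N => ?_
  simp only [Function.comp_apply]
  rw [one_div, inv_mul_eq_div, Nat.floor_div_eq_div]

lemma tendsto_sqrt_div_self (c : ℝ) :
    Tendsto (fun N : ℕ => √(c * N + 1) / N) atTop (nhds 0) := by
  have h1 : Tendsto (fun N : ℕ => c * (N : ℝ)⁻¹ + (N : ℝ)⁻¹ * (N : ℝ)⁻¹) atTop (nhds 0) := by
    have := tendsto_inv_atTop_zero.comp (tendsto_natCast_atTop_atTop (R := ℝ))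
    simpa using (this.const_mul c).add (this.mul this)
  have h2 := (Real.continuous_sqrt.tendsto 0).comp h1
  rw [Real.sqrt_zero] at h2
  refine h2.congr' ?_
  filter_upwards [eventually_gt_atTop 0] with N hN
  have hN' : (0 : ℝ) < N := by exact_mod_cast hN
  simp only [Function.comp_apply]
  rw [show c * (N : ℝ)⁻¹ + (N : ℝ)⁻¹ * (N : ℝ)⁻¹ = (c * N + 1) / (N : ℝ) ^ 2 by field_simp,
    Real.sqrt_div' _ (by positivity), Real.sqrt_sq hN'.le]

/-- The expected value, divided by the number of vertices, converges. -/
lemma exists_tendsto_expBestScore [NeZero q] {c : ℝ} (hc : 0 < c) :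
    ∃ H, Tendsto (fun N : ℕ => expBestScore q N ⌊c * N⌋₊ / N) atTop (nhds H) := by
  set a : ℕ → ℝ := fun N => expBestScore q N ⌊c * N⌋₊ with ha
  set v : ℕ → ℝ := fun n => (a n - √(c * n + 1)) / n with hv
  have hbdd : BddAbove (v '' Set.Ioi 0) := by
    refine ⟨c, ?_⟩
    rintro _ ⟨n, hn, rfl⟩
    have hn' : (0 : ℝ) < n := by exact_mod_cast Set.mem_Ioi.1 hn
    rw [hv]
    simp only
    rw [div_le_iff₀ hn']
    have h1 : a n ≤ ⌊c * n⌋₊ := expBestScore_le hn _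
    have h2 : (⌊c * n⌋₊ : ℝ) ≤ c * n := Nat.floor_le (by positivity)
    linarith [Real.sqrt_nonneg (c * n + 1)]
  refine ⟨sSup (v '' Set.Ioi 0), tendsto_order.2 ⟨fun l hl => ?_, fun u hu => ?_⟩⟩
  · obtain ⟨_, ⟨n, hn, rfl⟩, hln⟩ :=
      exists_lt_of_lt_csSup (Set.Nonempty.image v ⟨1, one_pos⟩) hl
    have hn0 : 0 < n := hn
    have ht := (tendsto_natDiv_div_self hn0).mul_const (a n - √(c * n + 1))
    rw [one_div_mul_eq_div] at ht
    filter_upwards [ht.eventually_const_lt hln, eventually_ge_atTop n] with N hN hnN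
    refine hN.trans_le ?_
    have hk : 0 < N / n := Nat.div_pos hnN hn0
    have h := expBestScore_blocks (q := q) (r := N % n) hc hn0 hk
    rw [Nat.div_add_mod'] at h
    rw [div_mul_eq_mul_div]
    exact div_le_div_of_nonneg_right h (Nat.cast_nonneg N)
  · have ht := (tendsto_sqrt_div_self c).const_add (sSup (v '' Set.Ioi 0))
    rw [add_zero] at ht
    filter_upwards [ht.eventually_lt_const hu, eventually_gt_atTop 0] with N hN hN0
    refine lt_of_le_of_lt ?_ hN
    have h := le_csSup hbdd ⟨N, hN0, rfl⟩
    rw [show v N = a N / N - √(c * N + 1) / N from sub_div _ _ _] at h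
    linarith

end Coloring

lemma probER_eq_walk {q N M : ℕ} (P : ((Fin N → Fin q) → ℕ) → Prop) :
    probER N M (fun E => P (∑ m, edgeScore q (E m))) =
      (uniformStep q (Fin N) ^ M) (fun g => if P g then 1 else 0) 0 := by
  rw [uniformStep, walkStep_pow_eq_sum, probER, Finset.card_filter]
  simp only [zero_add, Fintype.card_fun, Fintype.card_prod, Fintype.card_fin]
  push_cast
  rw [div_eq_inv_mul, ← inv_pow, sq]

/-- Chebyshev's inequality for the maximal score. -/
lemma probER_deviation_le {q N M : ℕ} [NeZero q] (hN : 0 < N) {t : ℝ} (ht : 0 < t)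
    {P : ℕ → Prop} (hP : ∀ b, P b → t ≤ |(b : ℝ) - expBestScore q N M|) :
    probER N M (fun E => P (maxColoring q E)) ≤ M / t ^ 2 := by
  have : Nonempty (Fin N) := ⟨⟨0, hN⟩⟩
  simp only [maxColoring_eq_bestScore]
  rw [probER_eq_walk fun g => P (bestScore g)]
  have hmono : Monotone (uniformStep q (Fin N)) := walkStep_mono (fun _ => by positivity) _
  have h1 := walkStep_pow_sub_sq_le (fun _ => by positivity) uniform_weight_sum
    (bestScore_le_add_edgeScore (q := q) (V := Fin N)) bestScore_add_edgeScore_le M 0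
  have h2 := monotone_end_pow hmono M
    (show (fun g => if P (bestScore g) then (1 : ℝ) else 0) ≤
      (t ^ 2)⁻¹ • fun g => ((bestScore g : ℝ) - expBestScore q N M) ^ 2 from fun g => by
        simp only [Pi.smul_apply, smul_eq_mul]
        split_ifs with h
        · rw [inv_mul_eq_div, one_le_div (by positivity), ← sq_abs ((bestScore g : ℝ) - _)]
          exact pow_le_pow_left₀ ht.le (hP _ h) 2
        · positivity) 0
  refine h2.trans ?_
  rw [map_smul, Pi.smul_apply, smul_eq_mul, inv_mul_eq_div]
  exact div_le_div_of_nonneg_right h1 (by positivity)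

/-- For the Erdős–Rényi multigraph `G(N, ⌊cN⌋)`, the partial `q`-coloring value normalized
by `N` converges with high probability to a constant `H(c)`. -/
theorem coloring_scaling_limit_ER (c : ℝ) (hc : 0 < c) (q : ℕ) (hq : 2 ≤ q) :
    ∃ H : ℝ,
      ∀ ε : ℝ, 0 < ε →
        Tendsto (fun N : ℕ =>
            probER N ⌊c * (N : ℝ)⌋₊
              (fun E => ε < |(maxColoring q E : ℝ) / (N : ℝ) - H|))
          atTop (nhds 0) := by
  have : NeZero q := ⟨by omega⟩
  obtain ⟨H, hH⟩ := exists_tendsto_expBestScore (q := q) hc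
  refine ⟨H, fun ε hε => ?_⟩
  have hlim : Tendsto (fun N : ℕ => 4 * c / ε ^ 2 * (N : ℝ)⁻¹) atTop (nhds 0) := by
    simpa using (tendsto_inv_atTop_zero.comp
      (tendsto_natCast_atTop_atTop (R := ℝ))).const_mul (4 * c / ε ^ 2)
  refine squeeze_zero' (Eventually.of_forall fun N => by unfold probER; positivity) ?_ hlim
  filter_upwards [eventually_gt_atTop 0, Metric.tendsto_nhds.1 hH (ε / 2) (half_pos hε)]
    with N hN hd
  have hN' : (0 : ℝ) < N := by exact_mod_cast hN
  rw [Real.dist_eq] at hd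
  refine (probER_deviation_le (t := ε / 2 * N) (P := fun b => ε < |(b : ℝ) / N - H|) hN
    (by positivity) fun b hb => ?_).trans ?_
  · set e := expBestScore q N ⌊c * (N : ℝ)⌋₊
    have h1 := abs_sub_le ((b : ℝ) / N) (e / N) H
    have h2 : |(b : ℝ) / N - e / N| = |(b : ℝ) - e| / N := by
      rw [← sub_div, abs_div, abs_of_pos hN']
    have h3 : ε / 2 ≤ |(b : ℝ) - e| / N := by linarith
    rwa [le_div_iff₀ hN'] at h3
  · have hM : (⌊c * (N : ℝ)⌋₊ : ℝ) ≤ c * N := Nat.floor_le (by positivity)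
    calc (⌊c * (N : ℝ)⌋₊ : ℝ) / (ε / 2 * N) ^ 2 ≤ c * N / (ε / 2 * N) ^ 2 :=
          div_le_div_of_nonneg_right hM (by positivity)
      _ = 4 * c / ε ^ 2 * (N : ℝ)⁻¹ := by
        field_simp
        ring
end
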